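/- arXiv:1308.4258 — 8 statements merged into one kernel-verified Lean document; each statement's English description precedes it below -/
import Mathlib

section
/- Let (A^{•,•}, ∂, ∂̄) be a bounded double complex of ℂ-vector spaces and let C^{•,•} ⊆ A^{•,•} be a sub-double-complex (a bigraded subspace preserved by ∂ and ∂̄). Suppose that: (1) for every p, the inclusion induces an isomorphism H^{p,•}(C^{p,•}, ∂̄) → H^{p,•}(A^{p,•}, ∂̄); (2) for every q, the inclusion induces an isomorphism H^{•,q}(C^{•,q}, ∂) → H^{•,q}(A^{•,q}, ∂); and (3) for every (p,q) ∈ ℤ², the induced map from (ker(d) ∩ C^{p,q} + im d)/im d ⊆ H^{p+q}_{dR}(C^{•,•}) to (ker(d) ∩ A^{p,q} + im d)/im d ⊆ H^{p+q}_{dR}(A^{•,•}) is surjective, where d = ∂ + ∂̄ on the total complexes. Then for every (p,q) ∈ ℤ² the induced map H^{p,q}_{BC}(C^{•,•}) → H^{p,q}_{BC}(A^{•,•}) on Bott-Chern cohomology is surjective. -/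
/-- Zigzag lemma: a staircase `x 0, x 1, …` with `d1 (x n) + d2 (x (n+1)) = 0` that is eventually
zero can be replaced, at its first step, by an element of the subcomplex, up to `im d1 + im d2`. -/
theorem zigzag_aux {M : Type*} [AddCommGroup M] [Module ℂ M]
    (A C : ℤ → ℤ → Submodule ℂ M) (d1 d2 : Module.End ℂ M)
    (hd2 : ∀ p q : ℤ, ∀ a ∈ A p q, d2 a ∈ A p (q + 1))
    (h22 : ∀ a, d2 (d2 a) = 0)
    (h12 : ∀ a, d1 (d2 a) = - d2 (d1 a))
    (hCA : ∀ p q : ℤ, C p q ≤ A p q)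
    (hC2 : ∀ p q : ℤ, ∀ a ∈ C p q, d2 a ∈ C p (q + 1))
    (h2surj : ∀ p q : ℤ, ∀ a ∈ A p q, d1 a = 0 →
      ∃ c ∈ C p q, d1 c = 0 ∧ a - c ∈ (A (p - 1) q).map d1)
    (h2inj : ∀ p q : ℤ, ∀ c ∈ C p q, d1 c = 0 → c ∈ (A (p - 1) q).map d1 →
      c ∈ (C (p - 1) q).map d1) (N : ℕ) :
    ∀ (p q : ℤ) (x : ℕ → M), (∀ n : ℕ, x n ∈ A (p + n) (q - n)) →
      (∀ n, d1 (x n) + d2 (x (n + 1)) = 0) → (∀ n, N ≤ n → x n = 0) →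
      ∃ c ∈ C p q, ∃ y ∈ A (p - 1) q, d1 (d2 c) = 0 ∧ d2 (x 0) = d2 c + d2 (d1 y) := by
  induction N with
  | zero =>
    intro p q x hx hr h0
    exact ⟨0, zero_mem _, 0, zero_mem _, by simp, by simp [h0 0 le_rfl]⟩
  | succ N ih =>
    intro p q x hx hr h0
    obtain ⟨c, hc, y, hy, hcc, hxy⟩ := ih (p + 1) (q - 1) (fun n => x (n + 1))
      (fun n => by
        have := hx (n + 1)
        push_cast at this
        convert this using 2 <;> ring)
      (fun n => hr (n + 1)) (fun n hn => h0 (n + 1) (by omega))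
    simp only [zero_add] at hxy
    have hx0 : x 0 ∈ A p q := by simpa using hx 0
    have hy' : y ∈ A p (q - 1) := by simpa using hy
    have hdy : d2 y ∈ A p q := by simpa using hd2 _ _ _ hy'
    have hdc : d2 c ∈ C (p + 1) q := by simpa using hC2 _ _ _ hc
    have e1 : d1 (x 0 - d2 y) = - d2 c := by
      have := hr 0
      rw [zero_add, hxy] at this
      rw [map_sub, h12, eq_neg_iff_add_eq_zero, ← this]
      abel
    obtain ⟨c', hc', hcc'⟩ := h2inj (p + 1) q (- d2 c) (neg_mem hdc) (by simp [hcc])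
      ⟨x 0 - d2 y, by simpa using sub_mem hx0 hdy, e1⟩
    have hc'' : c' ∈ C p q := by simpa using hc'
    obtain ⟨c2, hc2, hdc2, y2, hy2, hy2e⟩ := h2surj p q (x 0 - d2 y - c')
      (sub_mem (sub_mem hx0 hdy) (hCA _ _ hc'')) (by rw [map_sub, e1, hcc', sub_self])
    refine ⟨c' + c2, add_mem hc'' hc2, y2, hy2, ?_, ?_⟩
    · rw [h12, map_add, hcc', hdc2, add_zero, map_neg, h22]; simp
    · have : x 0 = c' + c2 + d1 y2 + d2 y := by rw [hy2e]; abel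
      rw [this]; simp [h22]


/-- **Theorem (surjBC), [angella-kasuya-1, Theorem 1.3].**
Let `(A^{•,•}, ∂, ∂̄)` be a bounded double complex of ℂ-vector spaces and let
`C^{•,•} ⊆ A^{•,•}` be a sub-double-complex. Suppose that:
(1) for every `p`, the inclusion induces an isomorphism on `∂̄`-cohomology;
(2) for every `q`, the inclusion induces an isomorphism on `∂`-cohomology;
(3) for every `(p,q)`, the induced map
`(ker d ∩ C^{p,q} + im d)/im d → (ker d ∩ A^{p,q} + im d)/im d` is surjective,
where `d = ∂ + ∂̄` on the total complexes.
Then for every `(p,q)` the induced map `H^{p,q}_{BC}(C) → H^{p,q}_{BC}(A)` is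
surjective. (All "induced map" conditions are phrased on representatives.) -/
theorem stmt0 (M : Type*) [AddCommGroup M] [Module ℂ M]
    (𝒜 : ℤ → ℤ → Submodule ℂ M)
    (hinternal : DirectSum.IsInternal fun pq : ℤ × ℤ => 𝒜 pq.1 pq.2)
    (hbound : {pq : ℤ × ℤ | 𝒜 pq.1 pq.2 ≠ ⊥}.Finite)
    (d1 d2 : Module.End ℂ M)
    (hd1 : ∀ p q : ℤ, (𝒜 p q).map d1 ≤ 𝒜 (p + 1) q)
    (hd2 : ∀ p q : ℤ, (𝒜 p q).map d2 ≤ 𝒜 p (q + 1))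
    (hd1sq : d1 * d1 = 0) (hd2sq : d2 * d2 = 0)
    (hanti : d1 * d2 + d2 * d1 = 0)
    (𝒞 : ℤ → ℤ → Submodule ℂ M)
    (hCA : ∀ p q : ℤ, 𝒞 p q ≤ 𝒜 p q)
    (hC1 : ∀ p q : ℤ, (𝒞 p q).map d1 ≤ 𝒞 (p + 1) q)
    (hC2 : ∀ p q : ℤ, (𝒞 p q).map d2 ≤ 𝒞 p (q + 1))
    -- (1) the inclusion induces an isomorphism on `∂̄`-cohomology:
    (h1surj : ∀ p q : ℤ, ∀ a ∈ 𝒜 p q, d2 a = 0 →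
      ∃ c ∈ 𝒞 p q, d2 c = 0 ∧ a - c ∈ (𝒜 p (q - 1)).map d2)
    (h1inj : ∀ p q : ℤ, ∀ c ∈ 𝒞 p q, d2 c = 0 → c ∈ (𝒜 p (q - 1)).map d2 →
      c ∈ (𝒞 p (q - 1)).map d2)
    -- (2) the inclusion induces an isomorphism on `∂`-cohomology:
    (h2surj : ∀ p q : ℤ, ∀ a ∈ 𝒜 p q, d1 a = 0 →
      ∃ c ∈ 𝒞 p q, d1 c = 0 ∧ a - c ∈ (𝒜 (p - 1) q).map d1)
    (h2inj : ∀ p q : ℤ, ∀ c ∈ 𝒞 p q, d1 c = 0 → c ∈ (𝒜 (p - 1) q).map d1 →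
      c ∈ (𝒞 (p - 1) q).map d1)
    -- (3) surjectivity on the de Rham classes of pure-bidegree cocycles:
    (h3 : ∀ p q : ℤ, ∀ a ∈ 𝒜 p q, (d1 + d2) a = 0 →
      ∃ c ∈ 𝒞 p q, (d1 + d2) c = 0 ∧
        a - c ∈ (⨆ r : ℤ, 𝒜 r (p + q - 1 - r)).map (d1 + d2)) :
    ∀ p q : ℤ, ∀ a ∈ 𝒜 p q, d1 a = 0 → d2 a = 0 →
      ∃ c ∈ 𝒞 p q, d1 c = 0 ∧ d2 c = 0 ∧
        a - c ∈ (𝒜 (p - 1) (q - 1)).map (d1 * d2) := by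
  have k1 : ∀ p q : ℤ, ∀ a ∈ 𝒜 p q, d1 a ∈ 𝒜 (p + 1) q := fun p q a ha => hd1 p q ⟨a, ha, rfl⟩
  have k2 : ∀ p q : ℤ, ∀ a ∈ 𝒜 p q, d2 a ∈ 𝒜 p (q + 1) := fun p q a ha => hd2 p q ⟨a, ha, rfl⟩
  have l1 : ∀ p q : ℤ, ∀ a ∈ 𝒞 p q, d1 a ∈ 𝒞 (p + 1) q := fun p q a ha => hC1 p q ⟨a, ha, rfl⟩
  have l2 : ∀ p q : ℤ, ∀ a ∈ 𝒞 p q, d2 a ∈ 𝒞 p (q + 1) := fun p q a ha => hC2 p q ⟨a, ha, rfl⟩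
  have h11 : ∀ a, d1 (d1 a) = 0 := fun a => LinearMap.congr_fun hd1sq a
  have h22 : ∀ a, d2 (d2 a) = 0 := fun a => LinearMap.congr_fun hd2sq a
  have han : ∀ a, d1 (d2 a) + d2 (d1 a) = 0 := fun a => LinearMap.congr_fun hanti a
  have h12 : ∀ a, d1 (d2 a) = - d2 (d1 a) := fun a => eq_neg_of_add_eq_zero_left (han a)
  have h21 : ∀ a, d2 (d1 a) = - d1 (d2 a) := fun a => eq_neg_of_add_eq_zero_right (han a)
  have hind := hinternal.submodule_iSupIndep
  intro p q a ha ha1 ha2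
  obtain ⟨c0, hc0, hdc0, x, hx, hxe⟩ := h3 p q a ha (by simp [ha1, ha2])
  have hc01 : d1 c0 = 0 := by
    have hdis : Disjoint (𝒜 (p + 1) q) (𝒜 p (q + 1)) :=
      hind.pairwiseDisjoint (i := (p + 1, q)) (j := (p, q + 1)) (by simp)
    have h := k1 _ _ _ (hCA _ _ hc0)
    refine Submodule.disjoint_def.mp hdis _ h ?_
    have e : d1 c0 = - d2 c0 := eq_neg_of_add_eq_zero_left (by simpa using hdc0)
    rw [e]
    exact neg_mem (k2 _ _ _ (hCA _ _ hc0))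
  have hc02 : d2 c0 = 0 := by simpa [hc01] using hdc0
  obtain ⟨f, hf, rfl⟩ := (Submodule.mem_iSup_iff_exists_finsupp _ _).mp hx
  have hb : a - c0 ∈ 𝒜 p q := sub_mem ha (hCA _ _ hc0)
  have hind' : iSupIndep fun r : ℤ => 𝒜 r (p + q - r) :=
    hind.comp (f := fun r : ℤ => (r, p + q - r)) (fun r s h => (Prod.mk.inj h).1)
  -- the components of `d f = a - c0`
  have hcomp : ∀ r, d1 (f (r - 1)) + d2 (f r) = if r = p then a - c0 else 0 := by
    intro r
    set U : Finset ℤ := insert p (f.support ∪ f.support.image (· + 1)) with hU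
    have key := (iSupIndep_iff_finsetSum_eq_imp_eq _).mp hind' U
      (fun r => d1 (f (r - 1)) + d2 (f r)) (fun r => if r = p then a - c0 else 0)
      (fun r _ => by
        refine ⟨add_mem ?_ ?_, ?_⟩
        · have := k1 _ _ _ (hf (r - 1))
          convert this using 2 <;> ring
        · have := k2 _ _ _ (hf r)
          convert this using 2; ring
        · split_ifs with h
          · subst h; simpa using hb
          · exact zero_mem _)
      (by
        have s1 : ∑ r ∈ U, d1 (f (r - 1)) = ∑ r ∈ f.support, d1 (f r) := by
          rw [← Finset.sum_subset (s₁ := f.support.image (· + 1))]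
          · rw [Finset.sum_image (by intro x _ y _ h; simpa using h)]
            simp
          · intro z hz; simp only [hU, Finset.mem_insert, Finset.mem_union]; tauto
          · intro z _ hz
            have : f (z - 1) = 0 := by
              by_contra hne
              exact hz (Finset.mem_image.mpr ⟨z - 1, by simpa using hne, by ring⟩)
            simp [this]
        have s2 : ∑ r ∈ U, d2 (f r) = ∑ r ∈ f.support, d2 (f r) := by
          rw [← Finset.sum_subset (s₁ := f.support)]
          · intro z hz; simp only [hU, Finset.mem_insert, Finset.mem_union]; tauto
          · intro z _ hz
            have : f z = 0 := by simpa using hz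
            simp [this]
        rw [Finset.sum_add_distrib, s1, s2, Finset.sum_ite_eq', if_pos (by simp [hU]), ← hxe]
        simp [Finsupp.sum, map_sum, Finset.sum_add_distrib])
    by_cases hr : r ∈ U
    · exact key r hr
    · simp only [hU, Finset.mem_insert, Finset.mem_union, not_or] at hr
      have e1 : f r = 0 := by simpa using hr.2.1
      have e2 : f (r - 1) = 0 := by
        by_contra hne
        exact hr.2.2 (Finset.mem_image.mpr ⟨r - 1, by simpa using hne, by ring⟩)
      simp [e1, e2, hr.1]
  obtain ⟨N, hN⟩ : ∃ N : ℕ, ∀ r : ℤ, N ≤ (r - p).natAbs → f r = 0 := by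
    refine ⟨f.support.sup (fun r => (r - p).natAbs) + 1, fun r hr => ?_⟩
    by_contra hne
    have := Finset.le_sup (f := fun r : ℤ => (r - p).natAbs) (Finsupp.mem_support_iff.mpr hne)
    omega
  obtain ⟨c, hc, y, hy, hcc, hxc⟩ := zigzag_aux 𝒜 𝒞 d1 d2 k2 h22 h12 hCA l2 h2surj h2inj N
    p (q - 1) (fun n => f (p + n))
    (fun n => by convert hf (p + n) using 2; ring)
    (fun n => by
      have := hcomp (p + (n + 1 : ℕ))
      rw [if_neg (by push_cast; omega)] at this
      convert this using 4
      push_cast; ring)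
    (fun n hn => hN _ (by omega))
  obtain ⟨c', hc', y', hy', hcc', hxc'⟩ := zigzag_aux (fun r s => 𝒜 s r) (fun r s => 𝒞 s r) d2 d1
    (fun r s => k1 s r) h11 h21 (fun r s => hCA s r) (fun r s => l1 s r)
    (fun r s => h1surj s r) (fun r s => h1inj s r) N
    q (p - 1) (fun n => f (p - 1 - n))
    (fun n => by
      have := hf (p - 1 - n)
      convert this using 2; ring)
    (fun n => by
      have := hcomp (p - 1 - n)
      rw [if_neg (by omega)] at this
      rw [← this, add_comm]
      congr 3
      push_cast; ring_nf)
    (fun n hn => hN _ (by omega))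
  have hp := hcomp p
  simp only [Nat.cast_zero, add_zero, sub_zero] at hxc hxc'
  rw [if_pos rfl, hxc, hxc'] at hp
  refine ⟨c0 + (d1 c' + d2 c), add_mem hc0 (add_mem ?_ ?_), ?_, ?_, y' - y, sub_mem hy' hy, ?_⟩
  · simpa using l1 _ _ _ hc'
  · simpa using l2 _ _ _ hc
  · simp [hc01, h11, hcc]
  · simp [hc02, h22, hcc']
  · rw [← sub_sub, ← hp, Module.End.mul_apply, map_sub, map_sub, h21 y]
    abel
end

section
/- Let (A^•, ∂, ∂̄) be a bounded bi-differential ℤ-graded complex of K-vector spaces (K = ℝ or ℂ) and let B^• ⊆ A^• be a bi-differential ℤ-graded sub-complex (a graded subspace preserved by ∂ and ∂̄). Suppose that: (1) the cohomologies H^•_∂(A^•), H^•_∂̄(A^•), H^•_∂(B^•), H^•_∂̄(B^•) are all finite-dimensional; (2) the inclusion ι : B^• ↪ A^• induces isomorphisms H^•_∂(B^•) → H^•_∂(A^•) and H^•_∂̄(B^•) → H^•_∂̄(A^•); (3) there exists a map μ : A^• → B^• of bi-differential ℤ-graded complexes (a graded linear map commuting with ∂ and with ∂̄) such that μ ∘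 ι = id_{B^•}. Then ι induces an isomorphism H^•_{BC}(B^•) → H^•_{BC}(A^•) on Bott-Chern cohomology. -/
/-- The cohomology `(ker d ∩ cur) / d(prev)` of a (graded piece of a) complex. -/
abbrev gradedCoh {K M : Type*} [Ring K] [AddCommGroup M] [Module K M]
    (d : Module.End K M) (cur prev : Submodule K M) : Type _ :=
  ↥(LinearMap.ker d ⊓ cur) ⧸
    Submodule.comap (LinearMap.ker d ⊓ cur).subtype (prev.map d)

/-- **Corollary (ives).**
Let `(A^•, ∂, ∂̄)` be a bounded bi-differential ℤ-graded complex of `K`-vector spaces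
(`K = ℝ` or `ℂ`) and `B^• ⊆ A^•` a bi-differential ℤ-graded sub-complex. Suppose that:
(1) `H^•_∂` and `H^•_∂̄` of both `A^•` and `B^•` are finite-dimensional;
(2) the inclusion `ι : B^• ↪ A^•` induces isomorphisms on `H^•_∂` and `H^•_∂̄`;
(3) there is a map `μ : A^• → B^•` of bi-differential ℤ-graded complexes with
`μ ∘ ι = id`. Then `ι` induces an isomorphism `H^•_{BC}(B^•) → H^•_{BC}(A^•)`
(injective and surjective on Bott-Chern classes). -/
theorem stmt1 (K : Type*) [RCLike K] (M : Type*) [AddCommGroup M] [Module K M]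
    (𝒜 : ℤ → Submodule K M) (hinternal : DirectSum.IsInternal 𝒜)
    (hbound : {k : ℤ | 𝒜 k ≠ ⊥}.Finite)
    (d1 d2 : Module.End K M)
    (hd1 : ∀ k : ℤ, (𝒜 k).map d1 ≤ 𝒜 (k + 1))
    (hd2 : ∀ k : ℤ, (𝒜 k).map d2 ≤ 𝒜 (k - 1))
    (hd1sq : d1 * d1 = 0) (hd2sq : d2 * d2 = 0)
    (hanti : d1 * d2 + d2 * d1 = 0)
    (ℬ : ℤ → Submodule K M)
    (hBA : ∀ k : ℤ, ℬ k ≤ 𝒜 k)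
    (hB1 : ∀ k : ℤ, (ℬ k).map d1 ≤ ℬ (k + 1))
    (hB2 : ∀ k : ℤ, (ℬ k).map d2 ≤ ℬ (k - 1))
    -- (1) finite-dimensionality of the `∂`- and `∂̄`-cohomologies of `A^•` and `B^•`:
    (hfdA1 : ∀ k : ℤ, FiniteDimensional K (gradedCoh d1 (𝒜 k) (𝒜 (k - 1))))
    (hfdA2 : ∀ k : ℤ, FiniteDimensional K (gradedCoh d2 (𝒜 k) (𝒜 (k + 1))))
    (hfdB1 : ∀ k : ℤ, FiniteDimensional K (gradedCoh d1 (ℬ k) (ℬ (k - 1))))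
    (hfdB2 : ∀ k : ℤ, FiniteDimensional K (gradedCoh d2 (ℬ k) (ℬ (k + 1))))
    -- (2) the inclusion induces isomorphisms on `H^•_∂` and on `H^•_∂̄`:
    (h1surj : ∀ k : ℤ, ∀ a ∈ 𝒜 k, d1 a = 0 →
      ∃ b ∈ ℬ k, d1 b = 0 ∧ a - b ∈ (𝒜 (k - 1)).map d1)
    (h1inj : ∀ k : ℤ, ∀ b ∈ ℬ k, d1 b = 0 → b ∈ (𝒜 (k - 1)).map d1 →
      b ∈ (ℬ (k - 1)).map d1)
    (h2surj : ∀ k : ℤ, ∀ a ∈ 𝒜 k, d2 a = 0 →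
      ∃ b ∈ ℬ k, d2 b = 0 ∧ a - b ∈ (𝒜 (k + 1)).map d2)
    (h2inj : ∀ k : ℤ, ∀ b ∈ ℬ k, d2 b = 0 → b ∈ (𝒜 (k + 1)).map d2 →
      b ∈ (ℬ (k + 1)).map d2)
    -- (3) a retraction `μ` of bi-differential ℤ-graded complexes:
    (μ : Module.End K M)
    (hμdeg : ∀ k : ℤ, (𝒜 k).map μ ≤ ℬ k)
    (hμd1 : μ * d1 = d1 * μ) (hμd2 : μ * d2 = d2 * μ)
    (hμι : ∀ k : ℤ, ∀ b ∈ ℬ k, μ b = b) :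
    -- conclusion: `ι` induces an isomorphism on Bott-Chern cohomology
    (∀ k : ℤ, ∀ b ∈ ℬ k, d1 b = 0 → d2 b = 0 →
      b ∈ (𝒜 k).map (d1 * d2) → b ∈ (ℬ k).map (d1 * d2)) ∧
    (∀ k : ℤ, ∀ a ∈ 𝒜 k, d1 a = 0 → d2 a = 0 →
      ∃ b ∈ ℬ k, d1 b = 0 ∧ d2 b = 0 ∧ a - b ∈ (𝒜 k).map (d1 * d2)) := by
  have e1 : ∀ x, d1 (d1 x) = 0 := fun x => LinearMap.congr_fun hd1sq x
  have e12 : ∀ x, d1 (d2 x) + d2 (d1 x) = 0 := fun x => LinearMap.congr_fun hanti x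
  have e2 : ∀ x, d2 (d2 x) = 0 := fun x => LinearMap.congr_fun hd2sq x
  have m1 : ∀ x, μ (d1 x) = d1 (μ x) := fun x => LinearMap.congr_fun hμd1 x
  have m2 : ∀ x, μ (d2 x) = d2 (μ x) := fun x => LinearMap.congr_fun hμd2 x
  have mdeg : ∀ k, ∀ x ∈ 𝒜 k, μ x ∈ ℬ k := fun k x hx => hμdeg k ⟨x, hx, rfl⟩
  -- the kernel of `μ` is acyclic for both differentials
  have ac1 : ∀ k : ℤ, ∀ c ∈ 𝒜 k, μ c = 0 → d1 c = 0 →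
      ∃ x ∈ 𝒜 (k - 1), μ x = 0 ∧ d1 x = c := by
    intro k c hc hm h
    obtain ⟨b, hb, -, x, hx, hxe⟩ := h1surj k c hc h
    have hmx := mdeg _ x hx
    refine ⟨x - μ x, sub_mem hx (hBA _ hmx), by rw [map_sub, hμι _ _ hmx, sub_self], ?_⟩
    have h3 : μ (d1 x) = - b := by rw [hxe, map_sub, hm, hμι _ _ hb, zero_sub]
    rw [map_sub, ← m1, h3, hxe]; abel
  have ac2 : ∀ k : ℤ, ∀ c ∈ 𝒜 k, μ c = 0 → d2 c = 0 →
      ∃ x ∈ 𝒜 (k + 1), μ x = 0 ∧ d2 x = c := by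
    intro k c hc hm h
    obtain ⟨b, hb, -, x, hx, hxe⟩ := h2surj k c hc h
    have hmx := mdeg _ x hx
    refine ⟨x - μ x, sub_mem hx (hBA _ hmx), by rw [map_sub, hμι _ _ hmx, sub_self], ?_⟩
    have h3 : μ (d2 x) = - b := by rw [hxe, map_sub, hm, hμι _ _ hb, zero_sub]
    rw [map_sub, ← m2, h3, hxe]; abel
  obtain ⟨N, hN⟩ := hbound.bddBelow
  have key : ∀ n : ℕ, ∀ k : ℤ, k < N + n → ∀ c ∈ 𝒜 k, μ c = 0 → d1 c = 0 → d2 c = 0 →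
      ∃ x ∈ 𝒜 k, μ x = 0 ∧ d1 (d2 x) = c := by
    intro n
    induction n with
    | zero =>
      intro k hk c hc _ _ _
      have hbot : 𝒜 k = ⊥ := by
        by_contra hne
        have : N ≤ k := hN hne
        simp at hk
        omega
      rw [hbot, Submodule.mem_bot] at hc
      exact ⟨0, zero_mem _, by simp, by simp [hc]⟩
    | succ n ih =>
      intro k hk c hc hm h1 h2
      obtain ⟨y, hy, hym, hyc⟩ := ac1 k c hc hm h1
      have hdy : d1 (d2 y) = 0 := by
        have := e12 y
        rwa [hyc, h2, add_zero] at this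
      obtain ⟨e, he, hem, hee⟩ := ih (k - 1 - 1) (by push_cast at hk; omega) (d2 y)
        (hd2 _ ⟨y, hy, rfl⟩) (by rw [m2, hym, map_zero]) hdy (e2 y)
      have hde : d1 e ∈ 𝒜 (k - 1) := by
        have := hd1 _ ⟨e, he, rfl⟩
        rwa [sub_add_cancel] at this
      obtain ⟨f, hf, hfm, hfe⟩ := ac2 (k - 1) (y + d1 e) (add_mem hy hde)
        (by rw [map_add, m1, hem, hym, map_zero, add_zero])
        (by rw [map_add, ← hee]; exact e12 e)
      rw [sub_add_cancel] at hf
      exact ⟨f, hf, hfm, by rw [hfe, map_add, e1, add_zero, hyc]⟩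
  constructor
  · rintro k b hb - - ⟨x, hx, hxe⟩
    refine ⟨μ x, mdeg k x hx, ?_⟩
    change d1 (d2 x) = b at hxe
    change d1 (d2 (μ x)) = b
    rw [← m2, ← m1, hxe, hμι k b hb]
  · intro k a ha h1 h2
    have hma := mdeg k a ha
    obtain ⟨x, hx, -, hxe⟩ := key (k - N + 1).toNat k (by omega) (a - μ a)
      (sub_mem ha (hBA _ hma)) (by rw [map_sub, hμι _ _ hma, sub_self])
      (by rw [map_sub, ← m1, h1, map_zero, sub_zero])
      (by rw [map_sub, ← m2, h2, map_zero, sub_zero])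
    exact ⟨μ a, hma, by rw [← m1, h1, map_zero], by rw [← m2, h2, map_zero], x, hx, hxe⟩
end

section
/- Let (A^•, ∂, ∂̄) be a bounded bi-differential ℤ-graded complex with A^k = 0 for k < 0 or k > 2n, for some n ≥ 1. Suppose that: (1) the inclusion of the space H^•_{hr}(A^•) of harmonic elements into A^• induces a surjection H^•_{hr}(A^•) → H^•_∂(A^•); and (2) im ∂̄ ∩ ker ∂ = im ∂ ∩ ker ∂̄. Then im ∂̄ ∩ ker ∂ = im ∂∂̄ = im ∂ ∩ ker ∂̄. -/
theorem aux_comm {K M : Type*} [Field K] [AddCommGroup M] [Module K M]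
    (𝒜 : ℤ → Submodule K M) [DirectSum.Decomposition 𝒜] (d : Module.End K M) (s : ℤ)
    (hd : ∀ k : ℤ, (𝒜 k).map d ≤ 𝒜 (k + s)) (x : M) (k : ℤ) :
    (DirectSum.decompose 𝒜 (d x) (k + s) : M) = d (DirectSum.decompose 𝒜 x k : M) := by
  induction x using DirectSum.Decomposition.inductionOn 𝒜 with
  | zero => simp
  | add x y hx hy =>
    simp only [map_add, DirectSum.decompose_add, DirectSum.add_apply, Submodule.coe_add, hx, hy]
  | @homogeneous i m =>
    have hm : d (m : M) ∈ 𝒜 (i + s) := hd i (Submodule.mem_map_of_mem m.2)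
    by_cases h : i = k
    · subst h
      rw [DirectSum.decompose_of_mem_same 𝒜 hm, DirectSum.decompose_of_mem_same 𝒜 m.2]
    · rw [DirectSum.decompose_of_mem_ne 𝒜 hm (by omega), DirectSum.decompose_of_mem_ne 𝒜 m.2 h,
        map_zero]

/-- **Proposition (ddlam).**
Let `(A^•, ∂, ∂̄)` be a bounded bi-differential ℤ-graded complex of `K`-vector spaces
(`K = ℝ` or `ℂ`, encoded via `RCLike`), with `A^k = 0` for `k < 0` or `k > 2n`, `n ≥ 1`.
Suppose that (1) the inclusion of the harmonic elements induces a surjection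
`H^•_hr(A^•) → H^•_∂(A^•)`, and (2) `im ∂̄ ∩ ker ∂ = im ∂ ∩ ker ∂̄`.
Then `im ∂̄ ∩ ker ∂ = im ∂∂̄ = im ∂ ∩ ker ∂̄`. -/
theorem stmt5 (K : Type*) [RCLike K] (M : Type*) [AddCommGroup M] [Module K M]
    (𝒜 : ℤ → Submodule K M) (hinternal : DirectSum.IsInternal 𝒜)
    (n : ℕ) (hn : 1 ≤ n)
    (hbound : ∀ k : ℤ, (k < 0 ∨ 2 * (n : ℤ) < k) → 𝒜 k = ⊥)
    (d1 d2 : Module.End K M)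
    (hd1 : ∀ k : ℤ, (𝒜 k).map d1 ≤ 𝒜 (k + 1))
    (hd2 : ∀ k : ℤ, (𝒜 k).map d2 ≤ 𝒜 (k - 1))
    (hd1sq : d1 * d1 = 0) (hd2sq : d2 * d2 = 0)
    (hanti : d1 * d2 + d2 * d1 = 0)
    (hharm : ∀ a : M, d1 a = 0 →
      ∃ h : M, d1 h = 0 ∧ d2 h = 0 ∧ a - h ∈ LinearMap.range d1)
    (hlem : LinearMap.range d2 ⊓ LinearMap.ker d1
      = LinearMap.range d1 ⊓ LinearMap.ker d2) :
    LinearMap.range d2 ⊓ LinearMap.ker d1 = LinearMap.range (d1 * d2) ∧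
      LinearMap.range (d1 * d2) = LinearMap.range d1 ⊓ LinearMap.ker d2 := by
  classical
  letI := hinternal.chooseDecomposition
  have h11 : ∀ x, d1 (d1 x) = 0 := fun x => LinearMap.congr_fun hd1sq x
  have h22 : ∀ x, d2 (d2 x) = 0 := fun x => LinearMap.congr_fun hd2sq x
  have h12 : ∀ x, d1 (d2 x) = - d2 (d1 x) := fun x =>
    eq_neg_of_add_eq_zero_left (LinearMap.congr_fun hanti x)
  have c1 := aux_comm 𝒜 d1 1 hd1
  have c2 := aux_comm 𝒜 d2 (-1) hd2
  have key : ∀ m : ℕ, ∀ k : ℤ, 2 * (n : ℤ) < k + m → ∀ b ∈ 𝒜 k, d1 (d2 b) = 0 →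
      d2 b ∈ LinearMap.range (d1 * d2) := by
    intro m
    induction m with
    | zero =>
      intro k hk b hb _
      rw [hbound k (Or.inr (by simpa using hk)), Submodule.mem_bot] at hb
      simp [hb]
    | succ m ih =>
      intro k hk b hb hdb
      have hmem : d1 b ∈ LinearMap.range d1 ⊓ LinearMap.ker d2 := by
        refine ⟨⟨b, rfl⟩, ?_⟩
        have := h12 b
        rw [hdb] at this
        exact neg_eq_zero.mp this.symm
      rw [← hlem] at hmem
      obtain ⟨⟨c, hc⟩, -⟩ := hmem
      have hc' : d2 (DirectSum.decompose 𝒜 c (k + 2) : M) = d1 b := by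
        rw [← c2, hc, show k + 2 + -1 = k + 1 by ring, c1, DirectSum.decompose_of_mem_same 𝒜 hb]
      obtain ⟨f, hf⟩ := ih (k + 2) (by push_cast at hk; omega) _
        (DirectSum.decompose 𝒜 c (k + 2)).2 (by rw [hc', h11])
      rw [hc', Module.End.mul_apply] at hf
      obtain ⟨h, -, hh2, g, hg⟩ := hharm (b - d2 f) (by rw [map_sub, hf, sub_self])
      refine ⟨-g, ?_⟩
      have := congrArg d2 hg
      rw [map_sub, map_sub, hh2, h22, sub_zero, sub_zero] at this
      rw [Module.End.mul_apply, map_neg, map_neg, h12, neg_neg, this]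
  have main : LinearMap.range d2 ⊓ LinearMap.ker d1 = LinearMap.range (d1 * d2) := by
    apply le_antisymm
    · rintro _ ⟨⟨b, rfl⟩, hb⟩
      have hb : d1 (d2 b) = 0 := hb
      rw [← DirectSum.sum_support_decompose 𝒜 b, map_sum]
      refine Submodule.sum_mem _ fun k _ => ?_
      refine key (2 * n + 1 - k).toNat k (by omega) _ (DirectSum.decompose 𝒜 b k).2 ?_
      rw [← c2, ← c1, hb]
      simp
    · rintro _ ⟨x, rfl⟩
      exact ⟨⟨-d1 x, by rw [map_neg, Module.End.mul_apply, h12]⟩, h11 _⟩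
  exact ⟨main, main.symm.trans hlem⟩
end

section
/- Let (A^•, ∂, ∂̄) be a bounded bi-differential ℤ-graded complex with A^k = 0 for k < 0 or k > 2n, for some n ≥ 1. Suppose that im ∂̄ ∩ ker ∂ = im ∂∂̄ = im ∂ ∩ ker ∂̄. Then the inclusion of the space H^•_{hr}(A^•) of harmonic elements into A^• induces a surjection H^•_{hr}(A^•) → H^•_∂(A^•). -/
/-- **Proposition (delin).**
Let `(A^•, ∂, ∂̄)` be a bounded bi-differential ℤ-graded complex of `K`-vector spaces
(`K = ℝ` or `ℂ`), with `A^k = 0` for `k < 0` or `k > 2n`, `n ≥ 1`.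
Suppose `im ∂̄ ∩ ker ∂ = im ∂∂̄ = im ∂ ∩ ker ∂̄`. Then the inclusion of the space of
harmonic elements into `A^•` induces a surjection `H^•_hr(A^•) → H^•_∂(A^•)`:
every `∂`-closed element is `∂`-cohomologous to a harmonic one. -/
theorem stmt6 (K : Type*) [RCLike K] (M : Type*) [AddCommGroup M] [Module K M]
    (𝒜 : ℤ → Submodule K M) (hinternal : DirectSum.IsInternal 𝒜)
    (n : ℕ) (hn : 1 ≤ n)
    (hbound : ∀ k : ℤ, (k < 0 ∨ 2 * (n : ℤ) < k) → 𝒜 k = ⊥)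
    (d1 d2 : Module.End K M)
    (hd1 : ∀ k : ℤ, (𝒜 k).map d1 ≤ 𝒜 (k + 1))
    (hd2 : ∀ k : ℤ, (𝒜 k).map d2 ≤ 𝒜 (k - 1))
    (hd1sq : d1 * d1 = 0) (hd2sq : d2 * d2 = 0)
    (hanti : d1 * d2 + d2 * d1 = 0)
    (hlem1 : LinearMap.range d2 ⊓ LinearMap.ker d1 = LinearMap.range (d1 * d2))
    (hlem2 : LinearMap.range (d1 * d2) = LinearMap.range d1 ⊓ LinearMap.ker d2) :
    ∀ a : M, d1 a = 0 →
      ∃ h : M, d1 h = 0 ∧ d2 h = 0 ∧ a - h ∈ LinearMap.range d1 := by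
  intro a ha
  have hc : ∀ x, d1 (d2 x) + d2 (d1 x) = 0 := fun x => by
    simpa using LinearMap.congr_fun hanti x
  have hmem : d2 a ∈ LinearMap.range d2 ⊓ LinearMap.ker d1 := by
    refine ⟨⟨a, rfl⟩, ?_⟩
    have h := hc a
    rw [ha, map_zero, add_zero] at h
    exact h
  rw [hlem1] at hmem
  obtain ⟨b, hb⟩ := hmem
  have hb' : d1 (d2 b) = d2 a := hb
  refine ⟨a + d1 b, ?_, ?_, ⟨-b, ?_⟩⟩
  · have h : d1 (d1 b) = 0 := LinearMap.congr_fun hd1sq b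
    rw [map_add, ha, h, add_zero]
  · rw [map_add, ← hb']
    exact hc b
  · rw [map_neg]
    abel
end

section
/- Let (A^•, ∂, ∂̄) be a bounded bi-differential ℤ-graded complex with A^k = 0 for k < 0 or k > 2n, for some n ≥ 1. Suppose that im ∂̄ ∩ ker ∂ = im ∂ ∩ ker ∂̄. Then the following conditions are equivalent: (1) the inclusion of the space H^•_{hr}(A^•) of harmonic elements into A^• induces a surjection H^•_{hr}(A^•) → H^•_∂(A^•); (2) im ∂̄ ∩ ker ∂ = im ∂∂̄ = im ∂ ∩ ker ∂̄. -/
/-- **Corollary.**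
Let `(A^•, ∂, ∂̄)` be a bounded bi-differential ℤ-graded complex of `K`-vector spaces
(`K = ℝ` or `ℂ`), with `A^k = 0` for `k < 0` or `k > 2n`, `n ≥ 1`.
Suppose `im ∂̄ ∩ ker ∂ = im ∂ ∩ ker ∂̄`. Then the following are equivalent:
(1) the inclusion of harmonic elements induces a surjection `H^•_hr(A^•) → H^•_∂(A^•)`;
(2) `im ∂̄ ∩ ker ∂ = im ∂∂̄ = im ∂ ∩ ker ∂̄`. -/
theorem stmt7 (K : Type*) [RCLike K] (M : Type*) [AddCommGroup M] [Module K M]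
    (𝒜 : ℤ → Submodule K M) (hinternal : DirectSum.IsInternal 𝒜)
    (n : ℕ) (hn : 1 ≤ n)
    (hbound : ∀ k : ℤ, (k < 0 ∨ 2 * (n : ℤ) < k) → 𝒜 k = ⊥)
    (d1 d2 : Module.End K M)
    (hd1 : ∀ k : ℤ, (𝒜 k).map d1 ≤ 𝒜 (k + 1))
    (hd2 : ∀ k : ℤ, (𝒜 k).map d2 ≤ 𝒜 (k - 1))
    (hd1sq : d1 * d1 = 0) (hd2sq : d2 * d2 = 0)
    (hanti : d1 * d2 + d2 * d1 = 0)
    (hlem : LinearMap.range d2 ⊓ LinearMap.ker d1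
      = LinearMap.range d1 ⊓ LinearMap.ker d2) :
    (∀ a : M, d1 a = 0 →
        ∃ h : M, d1 h = 0 ∧ d2 h = 0 ∧ a - h ∈ LinearMap.range d1) ↔
      (LinearMap.range d2 ⊓ LinearMap.ker d1 = LinearMap.range (d1 * d2) ∧
        LinearMap.range (d1 * d2) = LinearMap.range d1 ⊓ LinearMap.ker d2) := by
  have h11 : ∀ x, d1 (d1 x) = 0 := fun x => by simpa using LinearMap.congr_fun hd1sq x
  have h22 : ∀ x, d2 (d2 x) = 0 := fun x => by simpa using LinearMap.congr_fun hd2sq x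
  have h12 : ∀ x, d1 (d2 x) = - d2 (d1 x) := fun x => by
    have := LinearMap.congr_fun hanti x
    simp only [LinearMap.add_apply, Module.End.mul_apply, LinearMap.zero_apply] at this
    exact eq_neg_of_add_eq_zero_left this
  constructor
  · intro hs
    have hle : LinearMap.range (d1 * d2) ≤ LinearMap.range d1 ⊓ LinearMap.ker d2 := by
      rintro _ ⟨y, rfl⟩
      refine ⟨⟨d2 y, rfl⟩, ?_⟩
      simp [h12, h22]
    have hind := hinternal.submodule_iSupIndep
    have htop := hinternal.submodule_iSup_eq_top
    have mapsup : ∀ (d : Module.End K M) (e : ℤ), (∀ k, (𝒜 k).map d ≤ 𝒜 (k + e)) →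
        ∀ (S T : Set ℤ), (∀ j ∈ S, j + e ∈ T) → ∀ x ∈ ⨆ j ∈ S, 𝒜 j, d x ∈ ⨆ j ∈ T, 𝒜 j := by
      intro d e hd S T hST x hx
      have : (⨆ j ∈ S, 𝒜 j) ≤ (⨆ j ∈ T, 𝒜 j).comap d := by
        refine iSup₂_le fun j hj => ?_
        rw [← Submodule.map_le_iff_le_comap]
        exact (hd j).trans (le_iSup₂_of_le (j + e) (hST j hj) le_rfl)
      exact this hx
    have hd2' : ∀ k : ℤ, (𝒜 k).map d2 ≤ 𝒜 (k + (-1)) := hd2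
    have key : ∀ m : ℕ, ∀ x ∈ LinearMap.range d1 ⊓ LinearMap.ker d2,
        x ∈ (⨆ j ∈ Set.Ici (2 * (n : ℤ) + 1 - m), 𝒜 j) → x ∈ LinearMap.range (d1 * d2) := by
      intro m
      induction m with
      | zero =>
        intro x _ hx
        have : (⨆ j ∈ Set.Ici (2 * (n : ℤ) + 1 - (0 : ℕ)), 𝒜 j) = ⊥ := by
          refine le_bot_iff.1 (iSup₂_le fun j hj => ?_)
          rw [hbound j]
          right
          simp only [Set.mem_Ici] at hj
          push_cast at hj
          omega
        rw [this, Submodule.mem_bot] at hx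
        rw [hx]
        exact Submodule.zero_mem _
      | succ m ih =>
        intro x hxW hx
        set k : ℤ := 2 * (n : ℤ) + 1 - (m + 1 : ℕ) with hk
        have hx2 := hxW
        rw [← hlem] at hx2
        obtain ⟨⟨z0, hz0⟩, hx1⟩ := hx2
        have hz0t : z0 ∈ (⨆ j ∈ Set.Ici (k + 1), 𝒜 j) ⊔ (⨆ j ∈ Set.Iio (k + 1), 𝒜 j) := by
          have : (⊤ : Submodule K M) ≤
              (⨆ j ∈ Set.Ici (k + 1), 𝒜 j) ⊔ (⨆ j ∈ Set.Iio (k + 1), 𝒜 j) := by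
            rw [← htop]
            refine iSup_le fun j => ?_
            by_cases hj : k + 1 ≤ j
            · exact le_sup_of_le_left (le_iSup₂_of_le j hj le_rfl)
            · exact le_sup_of_le_right (le_iSup₂_of_le j (not_le.1 hj) le_rfl)
          exact this trivial
        obtain ⟨z, hz, g, hg, hzg⟩ := Submodule.mem_sup.1 hz0t
        have hdz := mapsup d2 (-1) hd2' _ (Set.Ici k)
          (fun j hj => by simp only [Set.mem_Ici] at *; omega) z hz
        have hdg := mapsup d2 (-1) hd2' _ (Set.Iio k)
          (fun j hj => by simp only [Set.mem_Iio] at *; omega) g hg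
        have hdis : Disjoint (⨆ j ∈ Set.Ici k, 𝒜 j) (⨆ j ∈ Set.Iio k, 𝒜 j) :=
          hind.disjoint_biSup_biSup (Set.disjoint_left.2 fun j h1 h2 => by
            simp only [Set.mem_Ici, Set.mem_Iio] at *; omega)
        have hxe : d2 g = x - d2 z := by rw [← hz0, ← hzg, map_add]; abel
        have hg0 : d2 g = 0 :=
          Submodule.disjoint_def.1 hdis _ (hxe ▸ Submodule.sub_mem _ hx hdz) hdg
        have hxz : x = d2 z := by rw [hg0] at hxe; exact sub_eq_zero.1 hxe.symm
        have hx1' : d1 x = 0 := hx1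
        have hd1z := mapsup d1 1 hd1 _ (Set.Ici (2 * (n : ℤ) + 1 - m))
          (fun j hj => by simp only [Set.mem_Ici] at *; push_cast at hk; omega) z hz
        obtain ⟨w, hw⟩ := ih (d1 z) ⟨⟨z, rfl⟩, by
          rw [SetLike.mem_coe, LinearMap.mem_ker, ← neg_eq_zero, ← h12, ← hxz, hx1']⟩ hd1z
        obtain ⟨h, hh1, hh2, u, hu⟩ := hs (z - d2 w) (by
          rw [map_sub, ← hw]; simp)
        refine ⟨-u, ?_⟩
        have e : d2 (d1 u) = x := by
          rw [hu, map_sub, map_sub, h22, hh2, hxz]; simp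
        simp [h12, e]
    have hge : LinearMap.range d1 ⊓ LinearMap.ker d2 ≤ LinearMap.range (d1 * d2) := by
      intro x hx
      refine key (2 * n + 1) x hx ?_
      have : (⊤ : Submodule K M) ≤
          ⨆ j ∈ Set.Ici (2 * (n : ℤ) + 1 - (2 * n + 1 : ℕ)), 𝒜 j := by
        rw [← htop]
        refine iSup_le fun j => ?_
        by_cases hj : 0 ≤ j
        · exact le_iSup₂_of_le j (by simp only [Set.mem_Ici]; push_cast; omega) le_rfl
        · rw [hbound j (Or.inl (not_le.1 hj))]
          exact bot_le
      exact this trivial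
    have heq := le_antisymm hle hge
    exact ⟨hlem.trans heq.symm, heq⟩
  · rintro ⟨h2, -⟩ a ha
    have : d2 a ∈ LinearMap.range d2 ⊓ LinearMap.ker d1 :=
      ⟨⟨a, rfl⟩, by rw [SetLike.mem_coe, LinearMap.mem_ker, h12, ha]; simp⟩
    rw [h2] at this
    obtain ⟨b, hb⟩ := this
    rw [Module.End.mul_apply, h12] at hb
    refine ⟨a + d1 b, ?_, ?_, -b, ?_⟩
    · rw [map_add, ha, h11, add_zero]
    · rw [map_add, ← hb]; simp
    · simp
end

section
/- Let (A^{•,•}, ∂, ∂̄) be a bounded double complex of ℂ-vector spaces such that all the cohomologies H^{p,q}_∂(A^{•,•}) and H^{p,q}_∂̄(A^{•,•}) are finite-dimensional. Then for every k ∈ ℤ one has Σ_{p+q=k} dim H^{p,q}_{BC}(A^{•,•}) + Σ_{p+q=k} dim H^{p,q}_{A}(A^{•,•}) ≥ 2 · dim H^k_{dR}(A^{•,•}). Moreover, equality holds for every k ∈ ℤ if and only if the natural map ⊕_{p+q=•} H^{p,q}_{BC}(A^{•,•}) → H^•_{dR}(A^{•,•}) induced by the identity is injective (i.e., A^{•,•}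 satisfies the ∂∂̄-Lemma). -/
open LinearMap

/-- The cohomology `(ker d ∩ cur) / d(prev)`. -/
abbrev cohD {M : Type*} [AddCommGroup M] [Module ℂ M]
    (d : Module.End ℂ M) (cur prev : Submodule ℂ M) : Type _ :=
  ↥(ker d ⊓ cur) ⧸ Submodule.comap (ker d ⊓ cur).subtype (prev.map d)

/-- The Bott-Chern cohomology `(ker ∂ ∩ ker ∂̄ ∩ cur) / ∂∂̄(prev)`. -/
abbrev cohBC {M : Type*} [AddCommGroup M] [Module ℂ M]
    (d1 d2 : Module.End ℂ M) (cur prev : Submodule ℂ M) : Type _ :=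
  ↥(ker d1 ⊓ ker d2 ⊓ cur) ⧸
    Submodule.comap (ker d1 ⊓ ker d2 ⊓ cur).subtype (prev.map (d1 * d2))

/-- The Aeppli cohomology `(ker ∂∂̄ ∩ cur) / (∂(prev1) + ∂̄(prev2))`. -/
abbrev cohA {M : Type*} [AddCommGroup M] [Module ℂ M]
    (d1 d2 : Module.End ℂ M) (cur prev1 prev2 : Submodule ℂ M) : Type _ :=
  ↥(ker (d1 * d2) ⊓ cur) ⧸
    Submodule.comap (ker (d1 * d2) ⊓ cur).subtype (prev1.map d1 ⊔ prev2.map d2)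

/-- Length of the subquotient `Q / (P ∩ Q)`. -/
noncomputable def rl {M : Type*} [AddCommGroup M] [Module ℂ M] (P Q : Submodule ℂ M) : ℕ∞ :=
  Module.length ℂ (↥Q ⧸ Submodule.comap Q.subtype P)

section RL
variable {M : Type*} [AddCommGroup M] [Module ℂ M]

lemma rl_surj {P Q P' Q' : Submodule ℂ M} (f : M →ₗ[ℂ] M)
    (hQ : ∀ x ∈ Q, f x ∈ Q') (hP : ∀ x ∈ Q, x ∈ P → f x ∈ P')
    (hs : ∀ y ∈ Q', ∃ x ∈ Q, y - f x ∈ P') : rl P' Q' ≤ rl P Q := by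
  refine Module.length_le_of_surjective
    (Submodule.mapQ (Submodule.comap Q.subtype P) (Submodule.comap Q'.subtype P')
      (f.restrict hQ) ?_) ?_
  · rintro ⟨x, hx⟩ hxP
    exact hP x hx hxP
  · intro y
    obtain ⟨⟨y, hy⟩, rfl⟩ := Submodule.Quotient.mk_surjective _ y
    obtain ⟨x, hx, h⟩ := hs y hy
    refine ⟨Submodule.Quotient.mk ⟨x, hx⟩, ?_⟩
    rw [Submodule.mapQ_apply, eq_comm, Submodule.Quotient.eq]
    exact h

lemma rl_inj {P Q P' Q' : Submodule ℂ M} (f : M →ₗ[ℂ] M)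
    (hQ : ∀ x ∈ Q, f x ∈ Q') (hP : ∀ x ∈ Q, f x ∈ P' → x ∈ P) : rl P Q ≤ rl P' Q' := by
  have h1 : rl P Q ≤ rl (P'.comap f) Q :=
    rl_surj LinearMap.id (fun x hx => hx) (fun x hx h => hP x hx h)
      (fun y hy => ⟨y, hy, by simp⟩)
  refine h1.trans ?_
  refine Module.length_le_of_injective
    (Submodule.mapQ (Submodule.comap Q.subtype (P'.comap f)) (Submodule.comap Q'.subtype P')
      (f.restrict hQ) ?_) ?_
  · rintro ⟨x, hx⟩ hxP
    exact hxP
  · rw [injective_iff_map_eq_zero]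
    intro y
    obtain ⟨⟨y, hy⟩, rfl⟩ := Submodule.Quotient.mk_surjective _ y
    rw [Submodule.mapQ_apply, Submodule.Quotient.mk_eq_zero, Submodule.Quotient.mk_eq_zero]
    exact fun h => h

lemma rl_add {P Q R : Submodule ℂ M} (hPQ : P ≤ Q) (hQR : Q ≤ R) :
    rl P R = rl P Q + rl Q R := by
  refine Module.length_eq_add_of_exact
    (Submodule.mapQ (Submodule.comap Q.subtype P) (Submodule.comap R.subtype P)
      (Submodule.inclusion hQR) ?_)
    (Submodule.mapQ (Submodule.comap R.subtype P) (Submodule.comap R.subtype Q)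
      LinearMap.id ?_) ?_ ?_ ?_
  · rintro ⟨x, hx⟩ hxP
    exact hxP
  · rintro ⟨x, hx⟩ hxP
    exact hPQ hxP
  · rw [injective_iff_map_eq_zero]
    intro y
    obtain ⟨⟨y, hy⟩, rfl⟩ := Submodule.Quotient.mk_surjective _ y
    rw [Submodule.mapQ_apply, Submodule.Quotient.mk_eq_zero, Submodule.Quotient.mk_eq_zero]
    exact fun h => h
  · intro y
    obtain ⟨y, rfl⟩ := Submodule.Quotient.mk_surjective _ y
    exact ⟨Submodule.Quotient.mk y, rfl⟩
  · intro y
    obtain ⟨⟨y, hy⟩, rfl⟩ := Submodule.Quotient.mk_surjective _ y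
    rw [Submodule.mapQ_apply, Submodule.Quotient.mk_eq_zero]
    constructor
    · intro h
      exact ⟨Submodule.Quotient.mk ⟨y, h⟩, rfl⟩
    · rintro ⟨x, hx⟩
      obtain ⟨⟨x, hx'⟩, rfl⟩ := Submodule.Quotient.mk_surjective _ x
      rw [Submodule.mapQ_apply, Submodule.Quotient.eq] at hx
      have h2 : x - y ∈ P := hx
      have h3 : y = x - (x - y) := by abel
      change y ∈ Q
      rw [h3]
      exact Q.sub_mem hx' (hPQ h2)

lemma rl_eq_zero {P Q : Submodule ℂ M} : rl P Q = 0 ↔ Q ≤ P := by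
  unfold rl
  rw [Module.length_eq_zero_iff, Submodule.Quotient.subsingleton_iff,
    Submodule.comap_subtype_eq_top]

lemma rl_mono {P Q P' Q' : Submodule ℂ M} (hP : P' ≤ P) (hQ : Q ≤ Q') : rl P Q ≤ rl P' Q' :=
  rl_inj LinearMap.id (fun _ hx => hQ hx) (fun _ _ h => hP h)

/-- Second isomorphism theorem. -/
lemma rl_inf_sup (P Q : Submodule ℂ M) : rl (P ⊓ Q) Q = rl P (P ⊔ Q) := by
  apply le_antisymm
  · exact rl_inj LinearMap.id (fun x hx => Submodule.mem_sup_right hx) (fun x hx h => ⟨h, hx⟩)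
  · refine rl_surj LinearMap.id (fun x hx => Submodule.mem_sup_right hx) (fun x hx h => h.1) ?_
    intro y hy
    obtain ⟨a, ha, b, hb, rfl⟩ := Submodule.mem_sup.1 hy
    exact ⟨b, hb, by simpa using ha⟩

/-- Kernel/image additivity. -/
lemma rl_map (f : M →ₗ[ℂ] M) {B Z : Submodule ℂ M} (h : B ≤ Z) :
    rl B Z = rl (B ⊓ ker f) (Z ⊓ ker f) + rl (B.map f) (Z.map f) := by
  have e1 : rl B (B ⊔ (Z ⊓ ker f)) = rl (B ⊓ ker f) (Z ⊓ ker f) := by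
    rw [← rl_inf_sup]
    congr 1
    rw [← inf_assoc, inf_eq_left.2 h]
  have e2 : rl (B ⊔ (Z ⊓ ker f)) Z = rl (B.map f) (Z.map f) := by
    apply le_antisymm
    · refine rl_inj f (fun x hx => ⟨x, hx, rfl⟩) ?_
      rintro x hx ⟨b, hb, hbx⟩
      have : x = b + (x - b) := by abel
      rw [this]
      refine Submodule.add_mem_sup hb ⟨Z.sub_mem hx (h hb), ?_⟩
      change f (x - b) = 0
      rw [map_sub, hbx, sub_self]
    · refine rl_surj f (fun x hx => ⟨x, hx, rfl⟩) ?_ ?_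
      · intro x _ hx
        obtain ⟨a, ha, b, hb, rfl⟩ := Submodule.mem_sup.1 hx
        refine ⟨a, ha, ?_⟩
        rw [map_add, mem_ker.1 hb.2, add_zero]
      · rintro _ ⟨x, hx, rfl⟩
        exact ⟨x, hx, by simp⟩
  rw [← e1, ← e2]
  exact rl_add le_sup_left (sup_le h inf_le_left)

/-- The modular valuation identity. -/
lemma rl_valuation {I1 K1 I2 K2 : Submodule ℂ M} (h1 : I1 ≤ K1) (h2 : I2 ≤ K2) :
    rl (I1 ⊓ I2) (K1 ⊓ K2) + rl (I1 ⊔ I2) (K1 ⊔ K2) = rl I1 K1 + rl I2 K2 := by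
  have key : ∀ {I K X : Submodule ℂ M}, I ≤ K →
      rl I K = rl (X ⊓ I) (X ⊓ K) + rl (X ⊔ I) (X ⊔ K) := by
    intro I K X h
    rw [rl_add (le_sup_left : I ≤ I ⊔ (X ⊓ K)) (sup_le h inf_le_right), ← rl_inf_sup]
    congr 1
    · congr 1
      rw [← inf_assoc, inf_comm I X, inf_assoc, inf_eq_left.2 h]
    · rw [← sup_inf_assoc_of_le X h, rl_inf_sup]
      rw [sup_comm I X, sup_assoc, sup_eq_right.2 h]
  rw [rl_add (inf_le_inf_right I2 h1) (inf_le_inf_left K1 h2),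
    rl_add (sup_le_sup_right h1 I2) (sup_le_sup_left h2 K1), key (X := I2) h1, key (X := K1) h2]
  rw [inf_comm I2 I1, inf_comm I2 K1, sup_comm I2 I1, sup_comm I2 K1]
  abel

/-- `h_BC + h_A = h_1 + h_2 + a + f` in a single bidegree. -/
lemma rl_bc_a {I1 K1 I2 K2 I12 K12 : Submodule ℂ M} (h1 : I1 ≤ K1) (h2 : I2 ≤ K2)
    (hI : I12 ≤ I1 ⊓ I2) (hK : K1 ⊔ K2 ≤ K12) :
    rl I12 (K1 ⊓ K2) + rl (I1 ⊔ I2) K12 =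
      rl I1 K1 + rl I2 K2 + rl I12 (I1 ⊓ I2) + rl (K1 ⊔ K2) K12 := by
  rw [rl_add hI (inf_le_inf h1 h2), rl_add (sup_le_sup h1 h2) hK, ← rl_valuation h1 h2]
  abel

lemma rl_finrank {P Q : Submodule ℂ M} (h : rl P Q ≠ ⊤) :
    (Module.finrank ℂ (↥Q ⧸ Submodule.comap Q.subtype P) : ℕ∞) = rl P Q := by
  unfold rl at *
  rw [Module.length_ne_top_iff, isFiniteLength_iff_isNoetherian_isArtinian] at h
  have := h.1
  rw [Module.length_eq_finrank]

lemma rl_ne_top {P Q : Submodule ℂ M}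
    (h : FiniteDimensional ℂ (↥Q ⧸ Submodule.comap Q.subtype P)) : rl P Q ≠ ⊤ := by
  unfold rl
  rw [Module.length_eq_finrank]
  simp

end RL

/-- A bounded double complex together with its component projections. -/
structure Bi {M : Type*} [AddCommGroup M] [Module ℂ M] (𝒜 : ℤ → ℤ → Submodule ℂ M)
    (d1 d2 : Module.End ℂ M) (π : ℤ → ℤ → M →ₗ[ℂ] M) (lo hi : ℤ) : Prop where
  mem : ∀ p q x, π p q x ∈ 𝒜 p q
  self : ∀ p q x, x ∈ 𝒜 p q → π p q x = x
  other : ∀ p q p' q' x, x ∈ 𝒜 p q → (p ≠ p' ∨ q ≠ q') → π p' q' x = 0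
  top : ∀ x, x ∈ ⨆ p : ℤ, ⨆ q : ℤ, 𝒜 p q
  hd1 : ∀ p q x, x ∈ 𝒜 (p - 1) q → d1 x ∈ 𝒜 p q
  hd2 : ∀ p q x, x ∈ 𝒜 p (q - 1) → d2 x ∈ 𝒜 p q
  sq1 : ∀ x, d1 (d1 x) = 0
  sq2 : ∀ x, d2 (d2 x) = 0
  anti : ∀ x, d1 (d2 x) = - d2 (d1 x)
  bp : ∀ p q, (p < lo ∨ hi < p) → 𝒜 p q = ⊥
  bq : ∀ p q, (q < lo ∨ hi < q) → 𝒜 p q = ⊥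

lemma exists_bi {M : Type*} [AddCommGroup M] [Module ℂ M]
    (𝒜 : ℤ → ℤ → Submodule ℂ M)
    (hinternal : DirectSum.IsInternal fun pq : ℤ × ℤ => 𝒜 pq.1 pq.2)
    (hbound : {pq : ℤ × ℤ | 𝒜 pq.1 pq.2 ≠ ⊥}.Finite)
    (d1 d2 : Module.End ℂ M)
    (hd1 : ∀ p q : ℤ, (𝒜 p q).map d1 ≤ 𝒜 (p + 1) q)
    (hd2 : ∀ p q : ℤ, (𝒜 p q).map d2 ≤ 𝒜 p (q + 1))
    (hd1sq : d1 * d1 = 0) (hd2sq : d2 * d2 = 0)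
    (hanti : d1 * d2 + d2 * d1 = 0) :
    ∃ (π : ℤ → ℤ → M →ₗ[ℂ] M) (lo hi : ℤ), Bi 𝒜 d1 d2 π lo hi := by
  classical
  let e := LinearEquiv.ofBijective
    (DirectSum.coeLinearMap (fun pq : ℤ × ℤ => 𝒜 pq.1 pq.2)) hinternal
  let π : ℤ → ℤ → M →ₗ[ℂ] M := fun p q =>
    (𝒜 p q).subtype ∘ₗ (DirectSum.component ℂ (ℤ × ℤ) (fun pq : ℤ × ℤ => 𝒜 pq.1 pq.2) (p, q))
      ∘ₗ e.symm.toLinearMap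
  have he : ∀ p q x (hx : x ∈ 𝒜 p q), e.symm x =
      DirectSum.lof ℂ (ℤ × ℤ) (fun pq : ℤ × ℤ => 𝒜 pq.1 pq.2) (p, q) ⟨x, hx⟩ := by
    intro p q x hx
    rw [LinearEquiv.symm_apply_eq]
    change _ = DirectSum.coeLinearMap (fun pq : ℤ × ℤ => 𝒜 pq.1 pq.2) _
    rw [DirectSum.coeLinearMap_lof]
  obtain ⟨lo, hlo⟩ := (hbound.image Prod.fst |>.union (hbound.image Prod.snd)).bddBelow
  obtain ⟨hi, hhi⟩ := (hbound.image Prod.fst |>.union (hbound.image Prod.snd)).bddAbove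
  refine ⟨π, lo, hi, ⟨?_, ?_, ?_, ?_, ?_, ?_, ?_, ?_, ?_, ?_, ?_⟩⟩
  · intro p q x
    exact Subtype.mem _
  · intro p q x hx
    simp only [π, comp_apply, LinearEquiv.coe_coe, he p q x hx, DirectSum.component.lof_self,
      Submodule.subtype_apply]
  · intro p q p' q' x hx h
    have hne : (p, q) ≠ (p', q') := by
      intro h'
      rw [Prod.mk.injEq] at h'
      tauto
    simp only [π, comp_apply, LinearEquiv.coe_coe, he p q x hx]
    rw [DirectSum.component.of, dif_neg hne]
    simp
  · intro x
    have : x ∈ ⨆ pq : ℤ × ℤ, 𝒜 pq.1 pq.2 := by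
      rw [hinternal.submodule_iSup_eq_top]; trivial
    rwa [iSup_prod] at this
  · intro p q x hx
    simpa using hd1 _ _ ⟨x, hx, rfl⟩
  · intro p q x hx
    simpa using hd2 _ _ ⟨x, hx, rfl⟩
  · intro x
    exact LinearMap.congr_fun hd1sq x
  · intro x
    exact LinearMap.congr_fun hd2sq x
  · intro x
    exact eq_neg_of_add_eq_zero_left (LinearMap.congr_fun hanti x)
  · intro p q h
    by_contra hne
    have h1 := hlo (Or.inl ⟨(p, q), hne, rfl⟩)
    have h2 := hhi (Or.inl ⟨(p, q), hne, rfl⟩)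
    dsimp only at h1 h2
    omega
  · intro p q h
    by_contra hne
    have h1 := hlo (Or.inr ⟨(p, q), hne, rfl⟩)
    have h2 := hhi (Or.inr ⟨(p, q), hne, rfl⟩)
    dsimp only at h1 h2
    omega

/-- Total degree part. -/
abbrev Tk {M : Type*} [AddCommGroup M] [Module ℂ M] (𝒜 : ℤ → ℤ → Submodule ℂ M) (k : ℤ) :
    Submodule ℂ M := ⨆ r : ℤ, 𝒜 r (k - r)

lemma Tk_flip {M : Type*} [AddCommGroup M] [Module ℂ M] (𝒜 : ℤ → ℤ → Submodule ℂ M) (k : ℤ) :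
    Tk (fun p q => 𝒜 q p) k = Tk 𝒜 k := by
  unfold Tk
  rw [← (Equiv.subLeft k).iSup_comp]
  simp

namespace Bi
variable {M : Type*} [AddCommGroup M] [Module ℂ M] {𝒜 : ℤ → ℤ → Submodule ℂ M}
    {d1 d2 : Module.End ℂ M} {π : ℤ → ℤ → M →ₗ[ℂ] M} {lo hi : ℤ}

lemma flip (h : Bi 𝒜 d1 d2 π lo hi) :
    Bi (fun p q => 𝒜 q p) d2 d1 (fun p q => π q p) lo hi where
  mem p q x := h.mem q p x
  self p q x := h.self q p x
  other p q p' q' x hx hn := h.other q p q' p' x hx hn.symm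
  top x := by rw [iSup_comm]; exact h.top x
  hd1 p q x := h.hd2 q p x
  hd2 p q x := h.hd1 q p x
  sq1 := h.sq2
  sq2 := h.sq1
  anti x := by rw [h.anti, neg_neg]
  bp p q := h.bq q p
  bq p q := h.bp q p

lemma ext (h : Bi 𝒜 d1 d2 π lo hi) (f g : M →ₗ[ℂ] M)
    (hfg : ∀ p q x, x ∈ 𝒜 p q → f x = g x) (x : M) : f x = g x := by
  refine Submodule.iSup_induction _ (motive := fun x => f x = g x) (h.top x) ?_ (by simp) ?_
  · intro p x hx
    refine Submodule.iSup_induction _ (motive := fun x => f x = g x) hx ?_ (by simp) ?_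
    · intro q x hx
      exact hfg p q x hx
    · intro x y hx hy
      rw [map_add, map_add, hx, hy]
  · intro x y hx hy
    rw [map_add, map_add, hx, hy]

lemma c1 (h : Bi 𝒜 d1 d2 π lo hi) (p q : ℤ) (x : M) :
    π p q (d1 x) = d1 (π (p - 1) q x) := by
  refine h.ext (π p q ∘ₗ d1) (d1 ∘ₗ π (p - 1) q) ?_ x
  intro p' q' x hx
  simp only [comp_apply]
  have h1 : d1 x ∈ 𝒜 (p' + 1) q' := h.hd1 _ _ _ (by simpa using hx)
  by_cases hp : p' = p - 1 ∧ q' = q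
  · obtain ⟨rfl, rfl⟩ := hp
    rw [h.self _ _ x hx, h.self]
    simpa using h1
  · rw [h.other p' q' _ _ x hx (by omega), h.other _ _ _ _ _ h1 (by omega), map_zero]

lemma c2 (h : Bi 𝒜 d1 d2 π lo hi) (p q : ℤ) (x : M) :
    π p q (d2 x) = d2 (π p (q - 1) x) := h.flip.c1 q p x

lemma zero (h : Bi 𝒜 d1 d2 π lo hi) (x : M) (hx : ∀ p q, π p q x = 0) : x = 0 := by
  have key := h.ext LinearMap.id
    (∑ p ∈ Finset.Icc lo hi, ∑ q ∈ Finset.Icc lo hi, π p q) ?_ x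
  · simpa [hx] using key
  · intro p q x hx
    by_cases hp : p ∈ Finset.Icc lo hi
    · by_cases hq : q ∈ Finset.Icc lo hi
      · simp only [id_apply, LinearMap.sum_apply]
        rw [Finset.sum_eq_single_of_mem p hp, Finset.sum_eq_single_of_mem q hq, h.self p q x hx]
        · intro b _ hb
          exact h.other _ _ _ _ _ hx (Or.inr hb.symm)
        · intro b _ hb
          exact Finset.sum_eq_zero fun c _ => h.other _ _ _ _ _ hx (Or.inl hb.symm)
      · rw [h.bq p q (by simp at hq; omega), Submodule.mem_bot] at hx
        simp [hx]
    · rw [h.bp p q (by simp at hp; omega), Submodule.mem_bot] at hx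
      simp [hx]

lemma tk_off (h : Bi 𝒜 d1 d2 π lo hi) {k : ℤ} {x : M} (hx : x ∈ Tk 𝒜 k) {p q : ℤ}
    (hpq : p + q ≠ k) : π p q x = 0 := by
  refine Submodule.iSup_induction _ (motive := fun x => π p q x = 0) hx ?_ (by simp) ?_
  · intro r x hx
    exact h.other _ _ _ _ _ hx (by omega)
  · intro x y hx hy
    rw [map_add, hx, hy, add_zero]

lemma tk_zero (h : Bi 𝒜 d1 d2 π lo hi) {k : ℤ} {x : M} (hx : x ∈ Tk 𝒜 k)
    (h0 : ∀ p, π p (k - p) x = 0) : x = 0 := by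
  refine h.zero x fun p q => ?_
  by_cases hpq : p + q = k
  · have : q = k - p := by omega
    rw [this, h0]
  · exact h.tk_off hx hpq

lemma mem_tk (p q k : ℤ) (hk : p + q = k) {x : M} (hx : x ∈ 𝒜 p q) : x ∈ Tk 𝒜 k := by
  have : q = k - p := by omega
  rw [this] at hx
  exact Submodule.mem_iSup_of_mem p hx

lemma d_tk (h : Bi 𝒜 d1 d2 π lo hi) {k : ℤ} {x : M} (hx : x ∈ Tk 𝒜 (k - 1)) :
    (d1 + d2) x ∈ Tk 𝒜 k := by
  refine Submodule.iSup_induction _ (motive := fun x => (d1 + d2) x ∈ Tk 𝒜 k) hx ?_ (by simp) ?_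
  · intro r x hx
    rw [LinearMap.add_apply]
    refine Submodule.add_mem _ ?_ ?_
    · exact mem_tk (r + 1) (k - 1 - r) k (by ring) (h.hd1 _ _ _ (by simpa using hx))
    · refine mem_tk r (k - r) k (by ring) (h.hd2 _ _ _ ?_)
      convert hx using 2
      ring
  · intro x y hx hy
    rw [map_add]
    exact Submodule.add_mem _ hx hy

lemma dd (h : Bi 𝒜 d1 d2 π lo hi) (x : M) : (d1 + d2) ((d1 + d2) x) = 0 := by
  simp only [LinearMap.add_apply, map_add, h.sq1, h.sq2, h.anti]
  abel

end Bi

section Froe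
variable {M : Type*} [AddCommGroup M] [Module ℂ M]

/-- Total cocycles. -/
abbrev Zk (𝒜 : ℤ → ℤ → Submodule ℂ M) (d1 d2 : Module.End ℂ M) (k : ℤ) : Submodule ℂ M :=
  ker (d1 + d2) ⊓ Tk 𝒜 k

/-- Total coboundaries. -/
abbrev Bk (𝒜 : ℤ → ℤ → Submodule ℂ M) (d1 d2 : Module.End ℂ M) (k : ℤ) : Submodule ℂ M :=
  (Tk 𝒜 (k - 1)).map (d1 + d2)

/-- The filtration. -/
def Gk (π : ℤ → ℤ → M →ₗ[ℂ] M) (k p : ℤ) : Submodule ℂ M :=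
  ⨅ r : ℤ, ⨅ _ : r < p, ker (π r (k - r))

lemma mem_Gk {π : ℤ → ℤ → M →ₗ[ℂ] M} {k p : ℤ} {x : M} :
    x ∈ Gk π k p ↔ ∀ r < p, π r (k - r) x = 0 := by
  simp [Gk, Submodule.mem_iInf]

lemma Gk_succ (π : ℤ → ℤ → M →ₗ[ℂ] M) (k p : ℤ) :
    Gk π k p ⊓ ker (π p (k - p)) = Gk π k (p + 1) := by
  ext x
  rw [Submodule.mem_inf, mem_Gk, mem_Gk, mem_ker]
  constructor
  · rintro ⟨h1, h2⟩ r hr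
    rcases (Int.lt_add_one_iff.1 hr).lt_or_eq with h | rfl
    · exact h1 r h
    · exact h2
  · intro h
    exact ⟨fun r hr => h r (by omega), h p (by omega)⟩

/-- Leading terms of elements of `X ∩ G p`. -/
def lead (π : ℤ → ℤ → M →ₗ[ℂ] M) (k : ℤ) (X : Submodule ℂ M) (p : ℤ) : Submodule ℂ M :=
  (X ⊓ Gk π k p).map (π p (k - p))

lemma mem_lead {π : ℤ → ℤ → M →ₗ[ℂ] M} {k p : ℤ} {X : Submodule ℂ M} {y : M} :
    y ∈ lead π k X p ↔ ∃ x ∈ X, (∀ r < p, π r (k - r) x = 0) ∧ π p (k - p) x = y := by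
  constructor
  · rintro ⟨x, ⟨h1, h2⟩, h3⟩
    exact ⟨x, h1, mem_Gk.1 h2, h3⟩
  · rintro ⟨x, h1, h2, h3⟩
    exact ⟨x, ⟨h1, mem_Gk.2 h2⟩, h3⟩

variable {𝒜 : ℤ → ℤ → Submodule ℂ M}
    {d1 d2 : Module.End ℂ M} {π : ℤ → ℤ → M →ₗ[ℂ] M} {lo hi : ℤ}

lemma Bk_le_Zk (h : Bi 𝒜 d1 d2 π lo hi) (k : ℤ) : Bk 𝒜 d1 d2 k ≤ Zk 𝒜 d1 d2 k := by
  rintro _ ⟨y, hy, rfl⟩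
  exact ⟨h.dd y, h.d_tk hy⟩

lemma lead_mono {X Y : Submodule ℂ M} (hXY : X ≤ Y) (π : ℤ → ℤ → M →ₗ[ℂ] M) (k p : ℤ) :
    lead π k X p ≤ lead π k Y p := Submodule.map_mono (inf_le_inf_right _ hXY)

lemma froe_step (h : Bi 𝒜 d1 d2 π lo hi) (k : ℤ) (n : ℕ) :
    rl (Bk 𝒜 d1 d2 k) (Zk 𝒜 d1 d2 k) =
      rl (Bk 𝒜 d1 d2 k ⊓ Gk π k (lo + n)) (Zk 𝒜 d1 d2 k ⊓ Gk π k (lo + n)) +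
      ∑ i ∈ Finset.range n,
        rl (lead π k (Bk 𝒜 d1 d2 k) (lo + i)) (lead π k (Zk 𝒜 d1 d2 k) (lo + i)) := by
  induction n with
  | zero =>
    have hG : Gk π k (lo + (0 : ℕ)) = ⊤ := by
      rw [eq_top_iff]
      intro x _
      rw [mem_Gk]
      intro r hr
      have := h.mem r (k - r) x
      rwa [h.bp r _ (by left; simpa using hr), Submodule.mem_bot] at this
    rw [hG]
    simp
  | succ n ih =>
    rw [ih, rl_map (π (lo + n) (k - (lo + n))) (inf_le_inf_right _ (Bk_le_Zk h k)),
      inf_assoc, inf_assoc, Gk_succ, Finset.sum_range_succ]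
    push_cast
    rw [← add_assoc lo]
    unfold lead
    abel

lemma froe_sum (h : Bi 𝒜 d1 d2 π lo hi) (k : ℤ) :
    rl (Bk 𝒜 d1 d2 k) (Zk 𝒜 d1 d2 k) =
      ∑ᶠ p : ℤ, rl (lead π k (Bk 𝒜 d1 d2 k) p) (lead π k (Zk 𝒜 d1 d2 k) p) := by
  rw [froe_step h k (hi - lo + 1).toNat]
  have h0 : rl (Bk 𝒜 d1 d2 k ⊓ Gk π k (lo + (hi - lo + 1).toNat))
      (Zk 𝒜 d1 d2 k ⊓ Gk π k (lo + (hi - lo + 1).toNat)) = 0 := by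
    rw [rl_eq_zero]
    rintro x ⟨⟨_, hx⟩, hG⟩
    rw [SetLike.mem_coe, mem_Gk] at hG
    have : x = 0 := by
      refine h.tk_zero hx fun p => ?_
      by_cases hp : p < lo + (hi - lo + 1).toNat
      · exact hG p hp
      · have := h.mem p (k - p) x
        rwa [h.bp p _ (by right; omega), Submodule.mem_bot] at this
    rw [this]
    exact Submodule.zero_mem _
  rw [h0, zero_add]
  let ι : ℕ ↪ ℤ := ⟨fun i => lo + i, fun a b hab => by simpa using hab⟩
  rw [finsum_eq_sum_of_support_subset (s := (Finset.range (hi - lo + 1).toNat).map ι),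
    Finset.sum_map]
  · rfl
  · intro p hp
    by_contra hn
    apply hp
    simp only [rl_eq_zero]
    intro y hy
    obtain ⟨x, _, _, rfl⟩ := mem_lead.1 hy
    have hpp : p < lo ∨ hi < p := by
      by_contra hc
      apply hn
      simp only [Finset.coe_map, Set.mem_image, SetLike.mem_coe, Finset.mem_range]
      refine ⟨(p - lo).toNat, by omega, ?_⟩
      change lo + ((p - lo).toNat : ℤ) = p
      omega
    have := h.mem p (k - p) x
    rw [h.bp p _ hpp, Submodule.mem_bot] at this
    rw [this]
    exact Submodule.zero_mem _

/-- column cohomology length -/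
noncomputable abbrev h2l (𝒜 : ℤ → ℤ → Submodule ℂ M) (d2 : Module.End ℂ M) (p q : ℤ) : ℕ∞ :=
  rl ((𝒜 p (q - 1)).map d2) (ker d2 ⊓ 𝒜 p q)

lemma I2_le_lead (h : Bi 𝒜 d1 d2 π lo hi) (k p : ℤ) :
    (𝒜 p (k - p - 1)).map d2 ≤ lead π k (Bk 𝒜 d1 d2 k) p := by
  rintro _ ⟨v, hv, rfl⟩
  rw [SetLike.mem_coe] at hv
  rw [mem_lead]
  refine ⟨(d1 + d2) v, ⟨v, Bi.mem_tk p (k - p - 1) _ (by ring) hv, rfl⟩, ?_, ?_⟩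
  · intro r hr
    rw [LinearMap.add_apply, map_add, h.c1, h.c2, h.other _ _ _ _ _ hv (by omega),
      h.other _ _ _ _ _ hv (by omega)]
    simp
  · rw [LinearMap.add_apply, map_add, h.c1, h.c2, h.other _ _ _ _ _ hv (by omega),
      h.self _ _ _ hv]
    simp

lemma lead_le_K2 (h : Bi 𝒜 d1 d2 π lo hi) (k p : ℤ) :
    lead π k (Zk 𝒜 d1 d2 k) p ≤ ker d2 ⊓ 𝒜 p (k - p) := by
  intro y hy
  obtain ⟨x, ⟨hx, hxT⟩, h0, rfl⟩ := mem_lead.1 hy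
  refine ⟨?_, h.mem _ _ _⟩
  have h1 : π p (k - p + 1) ((d1 + d2) x) = 0 := by
    rw [mem_ker.1 hx, map_zero]
  have e : k - p + 1 = k - (p - 1) := by ring
  rw [LinearMap.add_apply, map_add, h.c1, h.c2, add_sub_cancel_right, e,
    h0 (p - 1) (by omega), map_zero, zero_add] at h1
  exact h1

lemma h2l_eq (h : Bi 𝒜 d1 d2 π lo hi) (k p : ℤ) :
    h2l 𝒜 d2 p (k - p) = rl ((𝒜 p (k - p - 1)).map d2) (lead π k (Bk 𝒜 d1 d2 k) p) +
      rl (lead π k (Bk 𝒜 d1 d2 k) p) (lead π k (Zk 𝒜 d1 d2 k) p) +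
      rl (lead π k (Zk 𝒜 d1 d2 k) p) (ker d2 ⊓ 𝒜 p (k - p)) := by
  have hBZ := lead_mono (Bk_le_Zk h k) π k p
  rw [h2l, rl_add (I2_le_lead h k p) (hBZ.trans (lead_le_K2 h k p)),
    rl_add hBZ (lead_le_K2 h k p), add_assoc]

lemma h2l_bot {p q : ℤ} (hA : 𝒜 p q = ⊥) : h2l 𝒜 d2 p q = 0 := by
  rw [h2l, hA, rl_eq_zero]; simp

/-- `Σ h_2 = b_k + error`. -/
lemma froe_eq (h : Bi 𝒜 d1 d2 π lo hi) (k : ℤ) :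
    ∑ p ∈ Finset.Icc lo hi, h2l 𝒜 d2 p (k - p) =
      rl (Bk 𝒜 d1 d2 k) (Zk 𝒜 d1 d2 k) +
      ∑ p ∈ Finset.Icc lo hi, (rl ((𝒜 p (k - p - 1)).map d2) (lead π k (Bk 𝒜 d1 d2 k) p) +
        rl (lead π k (Zk 𝒜 d1 d2 k) p) (ker d2 ⊓ 𝒜 p (k - p))) := by
  rw [froe_sum h k, finsum_eq_sum_of_support_subset (s := Finset.Icc lo hi),
    ← Finset.sum_add_distrib]
  · refine Finset.sum_congr rfl fun p _ => ?_
    rw [h2l_eq h k p]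
    abel
  · intro p hp
    by_contra hn
    apply hp
    have : h2l 𝒜 d2 p (k - p) = 0 := by
      apply h2l_bot
      apply h.bp
      simp at hn
      omega
    rw [h2l_eq h k p] at this
    simp only [add_eq_zero] at this
    exact this.1.2

end Froe

section Main
variable {M : Type*} [AddCommGroup M] [Module ℂ M]

/-- row cohomology length -/
noncomputable abbrev h1l (𝒜 : ℤ → ℤ → Submodule ℂ M) (d1 : Module.End ℂ M) (p q : ℤ) : ℕ∞ :=
  rl ((𝒜 (p - 1) q).map d1) (ker d1 ⊓ 𝒜 p q)

/-- length of `(im ∂ ∩ im ∂̄) / im ∂∂̄` -/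
noncomputable def aL (𝒜 : ℤ → ℤ → Submodule ℂ M) (d1 d2 : Module.End ℂ M) (p q : ℤ) : ℕ∞ :=
  rl ((𝒜 (p - 1) (q - 1)).map (d1 * d2)) ((𝒜 (p - 1) q).map d1 ⊓ (𝒜 p (q - 1)).map d2)

/-- length of `ker ∂∂̄ / (ker ∂ + ker ∂̄)` -/
noncomputable def fL (𝒜 : ℤ → ℤ → Submodule ℂ M) (d1 d2 : Module.End ℂ M) (p q : ℤ) : ℕ∞ :=
  rl ((ker d1 ⊓ 𝒜 p q) ⊔ (ker d2 ⊓ 𝒜 p q)) (ker (d1 * d2) ⊓ 𝒜 p q)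

/-- Bott-Chern length -/
noncomputable abbrev bcL (𝒜 : ℤ → ℤ → Submodule ℂ M) (d1 d2 : Module.End ℂ M) (p q : ℤ) : ℕ∞ :=
  rl ((𝒜 (p - 1) (q - 1)).map (d1 * d2)) (ker d1 ⊓ ker d2 ⊓ 𝒜 p q)

/-- Aeppli length -/
noncomputable abbrev apL (𝒜 : ℤ → ℤ → Submodule ℂ M) (d1 d2 : Module.End ℂ M) (p q : ℤ) : ℕ∞ :=
  rl ((𝒜 (p - 1) q).map d1 ⊔ (𝒜 p (q - 1)).map d2) (ker (d1 * d2) ⊓ 𝒜 p q)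

variable {𝒜 : ℤ → ℤ → Submodule ℂ M}
    {d1 d2 : Module.End ℂ M} {π : ℤ → ℤ → M →ₗ[ℂ] M} {lo hi : ℤ}

lemma I1_le_K1 (h : Bi 𝒜 d1 d2 π lo hi) (p q : ℤ) :
    (𝒜 (p - 1) q).map d1 ≤ ker d1 ⊓ 𝒜 p q := by
  rintro _ ⟨x, hx, rfl⟩
  exact ⟨h.sq1 x, h.hd1 _ _ _ hx⟩

lemma I2_le_K2 (h : Bi 𝒜 d1 d2 π lo hi) (p q : ℤ) :
    (𝒜 p (q - 1)).map d2 ≤ ker d2 ⊓ 𝒜 p q := by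
  rintro _ ⟨x, hx, rfl⟩
  exact ⟨h.sq2 x, h.hd2 _ _ _ hx⟩

lemma I12_le (h : Bi 𝒜 d1 d2 π lo hi) (p q : ℤ) :
    (𝒜 (p - 1) (q - 1)).map (d1 * d2) ≤ (𝒜 (p - 1) q).map d1 ⊓ (𝒜 p (q - 1)).map d2 := by
  rintro _ ⟨x, hx, rfl⟩
  refine ⟨⟨d2 x, h.hd2 _ _ _ hx, rfl⟩, ⟨- d1 x, Submodule.neg_mem _ (h.hd1 _ _ _ hx), ?_⟩⟩
  rw [map_neg]
  exact (h.anti x).symm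

lemma le_K12 (h : Bi 𝒜 d1 d2 π lo hi) (p q : ℤ) :
    (ker d1 ⊓ 𝒜 p q) ⊔ (ker d2 ⊓ 𝒜 p q) ≤ ker (d1 * d2) ⊓ 𝒜 p q := by
  refine sup_le ?_ ?_
  · rintro x ⟨hx, hA⟩
    refine ⟨?_, hA⟩
    change d1 (d2 x) = 0
    rw [h.anti, mem_ker.1 hx, map_zero, neg_zero]
  · rintro x ⟨hx, hA⟩
    refine ⟨?_, hA⟩
    change d1 (d2 x) = 0
    rw [mem_ker.1 hx, map_zero]

lemma bc_ap (h : Bi 𝒜 d1 d2 π lo hi) (p q : ℤ) :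
    bcL 𝒜 d1 d2 p q + apL 𝒜 d1 d2 p q =
      h1l 𝒜 d1 p q + h2l 𝒜 d2 p q + aL 𝒜 d1 d2 p q + fL 𝒜 d1 d2 p q := by
  have := rl_bc_a (I1_le_K1 h p q) (I2_le_K2 h p q) (I12_le h p q) (le_K12 h p q)
  rw [← inf_inf_distrib_right] at this
  exact this

lemma aL_le (h : Bi 𝒜 d1 d2 π lo hi) (p q : ℤ) :
    aL 𝒜 d1 d2 p q ≤ h2l 𝒜 d2 (p - 1) q + fL 𝒜 d1 d2 (p - 1) q := by
  have e1 : aL 𝒜 d1 d2 p q ≤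
      rl ((𝒜 (p - 1) (q - 1)).map (d1 * d2)) ((𝒜 (p - 1) q).map d1 ⊓ ker d2) :=
    rl_mono le_rfl (inf_le_inf_left _ ((I2_le_K2 h p q).trans inf_le_left))
  have e2 : rl ((𝒜 (p - 1) (q - 1)).map (d1 * d2)) ((𝒜 (p - 1) q).map d1 ⊓ ker d2) ≤
      rl ((ker d1 ⊓ 𝒜 (p - 1) q) ⊔ (𝒜 (p - 1) (q - 1)).map d2)
        (ker (d1 * d2) ⊓ 𝒜 (p - 1) q) := by
    refine rl_surj d1 ?_ ?_ ?_
    · rintro x ⟨hx, hA⟩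
      refine ⟨⟨x, hA, rfl⟩, ?_⟩
      change d2 (d1 x) = 0
      rw [← neg_eq_zero, ← h.anti]
      exact hx
    · intro x _ hx
      obtain ⟨a, ha, _, ⟨b, hb, rfl⟩, rfl⟩ := Submodule.mem_sup.1 hx
      refine ⟨b, hb, ?_⟩
      rw [map_add, mem_ker.1 ha.1, zero_add]
      rfl
    · rintro _ ⟨⟨x, hx, rfl⟩, hy⟩
      refine ⟨x, ⟨?_, hx⟩, by simp⟩
      change d1 (d2 x) = 0
      rw [h.anti, mem_ker.1 hy, neg_zero]
  refine e1.trans (e2.trans ?_)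
  rw [rl_add (sup_le_sup_left (I2_le_K2 h (p - 1) q) _) (le_K12 h (p - 1) q)]
  refine add_le_add ?_ le_rfl
  refine rl_surj LinearMap.id (fun x hx => Submodule.mem_sup_right hx)
    (fun x _ hx => Submodule.mem_sup_right hx) ?_
  intro y hy
  obtain ⟨a, ha, b, hb, rfl⟩ := Submodule.mem_sup.1 hy
  exact ⟨b, hb, Submodule.mem_sup_left (by simpa using ha)⟩

lemma fL_le (h : Bi 𝒜 d1 d2 π lo hi) (p q : ℤ) :
    fL 𝒜 d1 d2 p q ≤ aL 𝒜 d1 d2 p (q + 1) + h1l 𝒜 d1 p (q + 1) := by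
  have e2 : fL 𝒜 d1 d2 p q ≤
      rl ((𝒜 (p - 1) (q + 1 - 1)).map (d1 * d2)) (ker d1 ⊓ (𝒜 p (q + 1 - 1)).map d2) := by
    refine rl_inj d2 ?_ ?_
    · rintro x ⟨hx, hA⟩
      refine ⟨hx, ⟨x, by simpa using hA, rfl⟩⟩
    · rintro x ⟨hx, hA⟩ ⟨b, hb, hbx⟩
      rw [add_sub_cancel_right, SetLike.mem_coe] at hb
      have hb1 : d1 b ∈ 𝒜 p q := h.hd1 _ _ _ hb
      have : x = - d1 b + (x + d1 b) := by abel
      rw [this]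
      refine Submodule.add_mem_sup ⟨?_, Submodule.neg_mem _ hb1⟩ ⟨?_, Submodule.add_mem _ hA hb1⟩
      · change d1 (- d1 b) = 0
        rw [map_neg, h.sq1, neg_zero]
      · change d2 (x + d1 b) = 0
        rw [map_add, ← hbx]
        change d1 (d2 b) + d2 (d1 b) = 0
        rw [h.anti, neg_add_cancel]
  refine e2.trans ?_
  rw [rl_add (I12_le h p (q + 1)) (inf_le_inf_right _ ((I1_le_K1 h p (q + 1)).trans inf_le_left))]
  refine add_le_add le_rfl ?_
  refine rl_inj LinearMap.id ?_ ?_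
  · rintro x ⟨hx, hx2⟩
    exact ⟨hx, (I2_le_K2 h p (q + 1) hx2).2⟩
  · rintro x ⟨_, hx2⟩ hx1
    exact ⟨hx1, hx2⟩

lemma aL_fin (h : Bi 𝒜 d1 d2 π lo hi) (H1 : ∀ p q, h1l 𝒜 d1 p q ≠ ⊤)
    (H2 : ∀ p q, h2l 𝒜 d2 p q ≠ ⊤) (n : ℕ) : ∀ p q, p < lo + n → aL 𝒜 d1 d2 p q ≠ ⊤ := by
  induction n with
  | zero =>
    intro p q hp
    have : aL 𝒜 d1 d2 p q = 0 := by
      unfold aL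
      rw [rl_eq_zero, h.bp (p - 1) q (by left; push_cast at hp; omega)]
      simp
    rw [this]
    simp
  | succ n ih =>
    intro p q hp
    refine ne_top_of_le_ne_top ?_ (aL_le h p q)
    refine WithTop.add_ne_top.2 ⟨H2 _ _, ?_⟩
    refine ne_top_of_le_ne_top ?_ (fL_le h _ _)
    exact WithTop.add_ne_top.2 ⟨ih _ _ (by push_cast at hp; omega), H1 _ _⟩

lemma sum_flip (h : Bi 𝒜 d1 d2 π lo hi) (k : ℤ) (f : ℤ → ℤ → ℕ∞)
    (hf : ∀ p q, 𝒜 p q = ⊥ → f p q = 0) :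
    ∑ p ∈ Finset.Icc lo hi, f p (k - p) = ∑ q ∈ Finset.Icc lo hi, f (k - q) q := by
  rw [← finsum_eq_sum_of_support_subset (s := Finset.Icc lo hi),
    ← finsum_eq_sum_of_support_subset (s := Finset.Icc lo hi),
    ← finsum_comp_equiv (Equiv.subLeft k)]
  · simp
  · intro p hp
    by_contra hn
    refine hp (hf _ _ (h.bq _ _ ?_))
    simp at hn
    omega
  · intro p hp
    by_contra hn
    refine hp (hf _ _ (h.bp _ _ ?_))
    simp at hn
    omega

lemma b_flip (𝒜 : ℤ → ℤ → Submodule ℂ M) (d1 d2 : Module.End ℂ M) (k : ℤ) :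
    rl (Bk (fun p q => 𝒜 q p) d2 d1 k) (Zk (fun p q => 𝒜 q p) d2 d1 k) =
    rl (Bk 𝒜 d1 d2 k) (Zk 𝒜 d1 d2 k) := by
  unfold Bk Zk
  rw [Tk_flip 𝒜 k, Tk_flip 𝒜 (k - 1), add_comm d2 d1]

lemma h1_sum (h : Bi 𝒜 d1 d2 π lo hi) (k : ℤ) :
    ∑ p ∈ Finset.Icc lo hi, h1l 𝒜 d1 p (k - p) =
    ∑ p ∈ Finset.Icc lo hi, h2l (fun p q => 𝒜 q p) d1 p (k - p) :=
  sum_flip h k (fun p q => h1l 𝒜 d1 p q) (fun p q hA => by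
    simp only [h1l]
    rw [hA, rl_eq_zero]; simp)

lemma F1 (h : Bi 𝒜 d1 d2 π lo hi) (k : ℤ) :
    rl (Bk 𝒜 d1 d2 k) (Zk 𝒜 d1 d2 k) ≤ ∑ p ∈ Finset.Icc lo hi, h2l 𝒜 d2 p (k - p) := by
  rw [froe_eq h k]
  exact le_self_add

lemma F1' (h : Bi 𝒜 d1 d2 π lo hi) (k : ℤ) :
    rl (Bk 𝒜 d1 d2 k) (Zk 𝒜 d1 d2 k) ≤ ∑ p ∈ Finset.Icc lo hi, h1l 𝒜 d1 p (k - p) := by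
  rw [h1_sum h, ← b_flip]
  exact F1 h.flip k

lemma F2 (h : Bi 𝒜 d1 d2 π lo hi) (k : ℤ)
    (hfin : rl (Bk 𝒜 d1 d2 k) (Zk 𝒜 d1 d2 k) ≠ ⊤)
    (heq : ∑ p ∈ Finset.Icc lo hi, h2l 𝒜 d2 p (k - p) = rl (Bk 𝒜 d1 d2 k) (Zk 𝒜 d1 d2 k))
    (p : ℤ) (z : M) (hz : z ∈ 𝒜 p (k - p)) (hzB : z ∈ Bk 𝒜 d1 d2 k) :
    z ∈ (𝒜 p (k - p - 1)).map d2 := by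
  rw [froe_eq h k] at heq
  have h0 : ∑ p ∈ Finset.Icc lo hi,
      (rl ((𝒜 p (k - p - 1)).map d2) (lead π k (Bk 𝒜 d1 d2 k) p) +
        rl (lead π k (Zk 𝒜 d1 d2 k) p) (ker d2 ⊓ 𝒜 p (k - p))) = (0 : ℕ∞) :=
    WithTop.add_left_cancel hfin (heq.trans (add_zero _).symm)
  by_cases hp : p ∈ Finset.Icc lo hi
  · have h1 := (Finset.sum_eq_zero_iff.1 h0) p hp
    rw [add_eq_zero, rl_eq_zero] at h1
    refine h1.1 (mem_lead.2 ⟨z, hzB, ?_, h.self _ _ _ hz⟩)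
    intro r hr
    exact h.other _ _ _ _ _ hz (by omega)
  · rw [h.bp p _ (by simp at hp; omega), Submodule.mem_bot] at hz
    rw [hz]
    exact Submodule.zero_mem _

lemma F2' (h : Bi 𝒜 d1 d2 π lo hi) (k : ℤ)
    (hfin : rl (Bk 𝒜 d1 d2 k) (Zk 𝒜 d1 d2 k) ≠ ⊤)
    (heq : ∑ p ∈ Finset.Icc lo hi, h1l 𝒜 d1 p (k - p) = rl (Bk 𝒜 d1 d2 k) (Zk 𝒜 d1 d2 k))
    (p : ℤ) (z : M) (hz : z ∈ 𝒜 p (k - p)) (hzB : z ∈ Bk 𝒜 d1 d2 k) :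
    z ∈ (𝒜 (p - 1) (k - p)).map d1 := by
  rw [h1_sum h, ← b_flip] at heq
  rw [← b_flip] at hfin
  have := F2 h.flip k hfin heq (k - p) z (by simpa using hz)
    (by unfold Bk at *; rwa [Tk_flip, add_comm d2 d1])
  simpa using this

lemma F3 (h : Bi 𝒜 d1 d2 π lo hi) (k : ℤ)
    (hB : ∀ p z, z ∈ 𝒜 p (k - p) → d1 z = 0 → d2 z = 0 → z ∈ Bk 𝒜 d1 d2 k →
      z ∈ (𝒜 p (k - p - 1)).map d2)
    (hZ : ∀ p u, u ∈ 𝒜 p (k - p) → d2 u = 0 → ∃ w ∈ 𝒜 p (k - p - 1), d1 (u - d2 w) = 0) :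
    ∑ p ∈ Finset.Icc lo hi, h2l 𝒜 d2 p (k - p) = rl (Bk 𝒜 d1 d2 k) (Zk 𝒜 d1 d2 k) := by
  rw [froe_eq h k]
  convert add_zero _
  refine Finset.sum_eq_zero fun p _ => ?_
  rw [add_eq_zero, rl_eq_zero, rl_eq_zero]
  constructor
  · intro t ht
    obtain ⟨_, ⟨y, hy, rfl⟩, h0, rfl⟩ := mem_lead.1 ht
    -- components of the boundary
    have hx : ∀ r, π r (k - r) ((d1 + d2) y) =
        d1 (π (r - 1) (k - r) y) + d2 (π r (k - r - 1) y) := by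
      intro r
      rw [LinearMap.add_apply, map_add, h.c1, h.c2]
    have hrec : ∀ r < p, d1 (π (r - 1) (k - r) y) = - d2 (π r (k - r - 1) y) := by
      intro r hr
      have := h0 r hr
      rw [hx] at this
      exact eq_neg_of_add_eq_zero_left this
    have hind : ∀ n : ℕ, ∀ r, r < lo + n → r ≤ p →
        d1 (π (r - 1) (k - r) y) ∈ Bk 𝒜 d1 d2 k := by
      intro n
      induction n with
      | zero =>
        intro r hr _
        have := h.mem (r - 1) (k - r) y
        rw [h.bp (r - 1) _ (by left; push_cast at hr; omega), Submodule.mem_bot] at this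
        rw [this, map_zero]
        exact Submodule.zero_mem _
      | succ n ih =>
        intro r hr hrp
        have i1 := ih (r - 1) (by push_cast at hr; omega) (by omega)
        rw [hrec (r - 1) (by omega)] at i1
        have e : k - (r - 1) - 1 = k - r := by ring
        rw [e] at i1
        have i2 : (d1 + d2) (π (r - 1) (k - r) y) ∈ Bk 𝒜 d1 d2 k :=
          ⟨_, Bi.mem_tk (r - 1) (k - r) _ (by ring) (h.mem _ _ _), rfl⟩
        have := Submodule.add_mem _ i2 i1
        simpa [LinearMap.add_apply] using this
    rw [hx]
    refine Submodule.add_mem _ ?_ ⟨_, h.mem _ _ _, rfl⟩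
    refine hB p _ (h.hd1 _ _ _ (h.mem _ _ _)) (h.sq1 _) ?_
      (hind (p - lo + 1).toNat p (by omega) le_rfl)
    have e1 := hrec (p - 1) (by omega)
    have e : k - (p - 1) - 1 = k - p := by ring
    rw [e] at e1
    rw [← neg_eq_zero, ← h.anti, ← neg_eq_zero, ← map_neg, ← e1, h.sq1]
  · rintro u ⟨hu, huA⟩
    obtain ⟨w, hw, hw1⟩ := hZ p u huA hu
    have h1 : d2 w ∈ lead π k (Zk 𝒜 d1 d2 k) p :=
      lead_mono (Bk_le_Zk h k) π k p (I2_le_lead h k p ⟨w, hw, rfl⟩)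
    have hm : u - d2 w ∈ 𝒜 p (k - p) := Submodule.sub_mem _ huA (h.hd2 _ _ _ hw)
    have h2 : u - d2 w ∈ lead π k (Zk 𝒜 d1 d2 k) p := by
      refine mem_lead.2 ⟨u - d2 w, ⟨?_, Bi.mem_tk p (k - p) k (by ring) hm⟩, ?_, h.self _ _ _ hm⟩
      · change (d1 + d2) (u - d2 w) = 0
        rw [LinearMap.add_apply, hw1, map_sub, h.sq2, mem_ker.1 hu]
        simp
      · intro r hr
        exact h.other _ _ _ _ _ hm (by omega)
    simpa using Submodule.add_mem _ h2 h1

lemma F3' (h : Bi 𝒜 d1 d2 π lo hi) (k : ℤ)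
    (hB : ∀ p z, z ∈ 𝒜 p (k - p) → d1 z = 0 → d2 z = 0 → z ∈ Bk 𝒜 d1 d2 k →
      z ∈ (𝒜 (p - 1) (k - p)).map d1)
    (hZ : ∀ p u, u ∈ 𝒜 p (k - p) → d1 u = 0 → ∃ w ∈ 𝒜 (p - 1) (k - p), d2 (u - d1 w) = 0) :
    ∑ p ∈ Finset.Icc lo hi, h1l 𝒜 d1 p (k - p) = rl (Bk 𝒜 d1 d2 k) (Zk 𝒜 d1 d2 k) := by
  rw [h1_sum h, ← b_flip]
  refine F3 h.flip k ?_ ?_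
  · intro q z hz h1 h2 hzB
    have e : k - q - 1 = (k - q) - 1 := rfl
    have := hB (k - q) z (by simpa using hz) h2 h1
      (by unfold Bk at *; rwa [Tk_flip, add_comm d2 d1] at hzB)
    simpa using this
  · intro q u hu h1
    have := hZ (k - q) u (by simpa using hu) h1
    simpa using this

end Main

section Final
variable {M : Type*} [AddCommGroup M] [Module ℂ M]
variable {𝒜 : ℤ → ℤ → Submodule ℂ M}
    {d1 d2 : Module.End ℂ M} {π : ℤ → ℤ → M →ₗ[ℂ] M} {lo hi : ℤ}

lemma enat_aux {b x y u v : ℕ∞} (hb : b ≠ ⊤) (hx : b ≤ x) (hy : b ≤ y)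
    (he : x + y + u + v = 2 * b) : x = b ∧ y = b ∧ u = 0 ∧ v = 0 := by
  lift b to ℕ using hb
  have ht : x + y + u + v ≠ ⊤ := by
    rw [he]
    exact_mod_cast ENat.natCast_ne_top (2 * b)
  obtain ⟨ht3, h4⟩ := WithTop.add_ne_top.1 ht
  obtain ⟨ht2, h3⟩ := WithTop.add_ne_top.1 ht3
  obtain ⟨h1, h2⟩ := WithTop.add_ne_top.1 ht2
  lift x to ℕ using h1
  lift y to ℕ using h2
  lift u to ℕ using h3
  lift v to ℕ using h4
  norm_cast at *
  omega

lemma finsum_cast (lo hi : ℤ) (g : ℤ → ℕ) (f : ℤ → ℕ∞) (hgf : ∀ p, (g p : ℕ∞) = f p)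
    (hf : ∀ p, (p < lo ∨ hi < p) → f p = 0) :
    ((∑ᶠ p, g p : ℕ) : ℕ∞) = ∑ p ∈ Finset.Icc lo hi, f p := by
  rw [finsum_eq_sum_of_support_subset (s := Finset.Icc lo hi), Nat.cast_sum]
  · exact Finset.sum_congr rfl fun p _ => hgf p
  · intro p hp
    by_contra hn
    apply hp
    have h0 := hf p (by simp at hn; omega)
    rw [← hgf] at h0
    exact_mod_cast h0

lemma fL_bot {p q : ℤ} (hA : 𝒜 p q = ⊥) : fL 𝒜 d1 d2 p q = 0 := by
  unfold fL
  rw [hA, rl_eq_zero]; simp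

lemma aL_bot (h : Bi 𝒜 d1 d2 π lo hi) {p q : ℤ} (hA : 𝒜 p q = ⊥) : aL 𝒜 d1 d2 p q = 0 := by
  unfold aL
  rw [rl_eq_zero]
  refine (inf_le_left.trans ((I1_le_K1 h p q).trans inf_le_right)).trans ?_
  rw [hA]
  exact bot_le

lemma total (h : Bi 𝒜 d1 d2 π lo hi) (k : ℤ) :
    ∑ p ∈ Finset.Icc lo hi, bcL 𝒜 d1 d2 p (k - p) +
      ∑ p ∈ Finset.Icc lo hi, apL 𝒜 d1 d2 p (k - p) =
    ∑ p ∈ Finset.Icc lo hi, h1l 𝒜 d1 p (k - p) + ∑ p ∈ Finset.Icc lo hi, h2l 𝒜 d2 p (k - p) +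
      ∑ p ∈ Finset.Icc lo hi, aL 𝒜 d1 d2 p (k - p) +
      ∑ p ∈ Finset.Icc lo hi, fL 𝒜 d1 d2 p (k - p) := by
  simp only [← Finset.sum_add_distrib]
  exact Finset.sum_congr rfl fun p _ => bc_ap h p (k - p)

/-- The `∂∂̄`-Lemma as in the statement. -/
def DDbar (𝒜 : ℤ → ℤ → Submodule ℂ M) (d1 d2 : Module.End ℂ M) : Prop :=
  ∀ (k : ℤ) (a : ℤ →₀ M),
        (∀ p : ℤ, a p ∈ ker d1 ⊓ ker d2 ⊓ 𝒜 p (k - p)) →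
        (a.sum fun _ m => m) ∈ (⨆ r : ℤ, 𝒜 r (k - 1 - r)).map (d1 + d2) →
        ∀ p : ℤ, a p ∈ (𝒜 (p - 1) (k - p - 1)).map (d1 * d2)

lemma ddbar_of_eq (h : Bi 𝒜 d1 d2 π lo hi)
    (hfin : ∀ k, rl (Bk 𝒜 d1 d2 k) (Zk 𝒜 d1 d2 k) ≠ ⊤)
    (heq : ∀ k, ∑ p ∈ Finset.Icc lo hi, bcL 𝒜 d1 d2 p (k - p) +
      ∑ p ∈ Finset.Icc lo hi, apL 𝒜 d1 d2 p (k - p) = 2 * rl (Bk 𝒜 d1 d2 k) (Zk 𝒜 d1 d2 k)) :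
    DDbar 𝒜 d1 d2 := by
  have key := fun k => enat_aux (hfin k) (F1' h k) (F1 h k) ((total h k).symm.trans (heq k))
  have ha : ∀ p q, aL 𝒜 d1 d2 p q = 0 := by
    intro p q
    by_cases hp : p ∈ Finset.Icc lo hi
    · simpa using Finset.sum_eq_zero_iff.1 (key (p + q)).2.2.1 p hp
    · exact aL_bot h (h.bp p q (by simp at hp; omega))
  have hf : ∀ p q, fL 𝒜 d1 d2 p q = 0 := by
    intro p q
    by_cases hp : p ∈ Finset.Icc lo hi
    · simpa using Finset.sum_eq_zero_iff.1 (key (p + q)).2.2.2 p hp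
    · exact fL_bot (h.bp p q (by simp at hp; omega))
  have hI : ∀ k p z, z ∈ 𝒜 p (k - p) → z ∈ Bk 𝒜 d1 d2 k →
      z ∈ (𝒜 (p - 1) (k - p - 1)).map (d1 * d2) := by
    intro k p z hz hzB
    exact rl_eq_zero.1 (ha p (k - p))
      ⟨F2' h k (hfin k) (key k).1 p z hz hzB, F2 h k (hfin k) (key k).2.1 p z hz hzB⟩
  have hK : ∀ p q y, y ∈ 𝒜 p q → d1 (d2 y) = 0 →
      ∃ u ∈ 𝒜 p q, ∃ v ∈ 𝒜 p q, d1 u = 0 ∧ d2 v = 0 ∧ u + v = y := by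
    intro p q y hy h0
    obtain ⟨u, hu, v, hv, e⟩ := Submodule.mem_sup.1 (rl_eq_zero.1 (hf p q) ⟨h0, hy⟩)
    exact ⟨u, hu.2, v, hv.2, hu.1, hv.1, e⟩
  intro k a haK hB p
  obtain ⟨y, hy, hyx⟩ := hB
  have hap : π p (k - p) (a.sum fun _ m => m) = a p := by
    rw [Finsupp.sum, map_sum]
    by_cases hp : p ∈ a.support
    · rw [Finset.sum_eq_single_of_mem p hp]
      · exact h.self _ _ _ (haK p).2
      · intro r _ hr
        exact h.other _ _ _ _ _ (haK r).2 (Or.inl hr)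
    · rw [Finsupp.notMem_support_iff.1 hp]
      refine Finset.sum_eq_zero fun r hr => ?_
      exact h.other _ _ _ _ _ (haK r).2 (Or.inl fun e => hp (e ▸ hr))
  rw [← hyx, LinearMap.add_apply, map_add, h.c1, h.c2] at hap
  have hk1 : d1 (a p) = 0 := (haK p).1.1
  have hk2 : d2 (a p) = 0 := (haK p).1.2
  obtain ⟨u, hu, v, hv, hu1, hv2, e⟩ := hK p (k - p - 1) (π p (k - p - 1) y) (h.mem _ _ _) (by
    rw [← hap, map_add, h.sq1, zero_add] at hk1
    exact hk1)
  obtain ⟨u', hu', v', hv', hu1', hv2', e'⟩ := hK (p - 1) (k - p) (π (p - 1) (k - p) y)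
    (h.mem _ _ _) (by
    rw [← hap, map_add, h.sq2, add_zero] at hk2
    rw [h.anti, hk2, neg_zero])
  rw [← hap]
  refine Submodule.add_mem _ ?_ ?_
  · refine hI k p _ (h.hd1 _ _ _ (h.mem _ _ _)) ?_
    refine ⟨v', Bi.mem_tk _ _ _ (by ring) hv', ?_⟩
    rw [← e', LinearMap.add_apply, hv2', map_add, hu1', add_zero, zero_add]
  · refine hI k p _ (h.hd2 _ _ _ (h.mem _ _ _)) ?_
    refine ⟨u, Bi.mem_tk _ _ _ (by ring) hu, ?_⟩
    rw [← e, LinearMap.add_apply, hu1, map_add, hv2, add_zero, zero_add]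

lemma eq_of_ddbar (h : Bi 𝒜 d1 d2 π lo hi) (hD : DDbar 𝒜 d1 d2) (k : ℤ) :
    ∑ p ∈ Finset.Icc lo hi, bcL 𝒜 d1 d2 p (k - p) +
      ∑ p ∈ Finset.Icc lo hi, apL 𝒜 d1 d2 p (k - p) =
        2 * rl (Bk 𝒜 d1 d2 k) (Zk 𝒜 d1 d2 k) := by
  have hB : ∀ k p z, z ∈ 𝒜 p (k - p) → d1 z = 0 → d2 z = 0 → z ∈ Bk 𝒜 d1 d2 k →
      z ∈ (𝒜 (p - 1) (k - p - 1)).map (d1 * d2) := by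
    intro k p z hz h1 h2 hzB
    have := hD k (Finsupp.single p z) ?_ (by simpa using hzB) p
    · simpa using this
    · intro r
      by_cases hr : r = p
      · subst hr
        simpa using ⟨⟨h1, h2⟩, hz⟩
      · rw [Finsupp.single_eq_of_ne hr]
        exact Submodule.zero_mem _
  have hC : ∀ p q u, u ∈ 𝒜 p q → d1 (d2 u) = 0 →
      d1 u ∈ (𝒜 p (q - 1)).map (d1 * d2) ∧ d2 u ∈ (𝒜 (p - 1) q).map (d1 * d2) := by
    intro p q u hu h0
    have h0' : d2 (d1 u) = 0 := by rw [← neg_eq_zero, ← h.anti, h0]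
    have hu1 : d1 u ∈ 𝒜 (p + 1) q := h.hd1 _ _ _ (by simpa using hu)
    have hu2 : d2 u ∈ 𝒜 p (q + 1) := h.hd2 _ _ _ (by simpa using hu)
    have key := hD (p + q + 1) (Finsupp.single (p + 1) (d1 u) + Finsupp.single p (d2 u)) ?_ ?_
    · have k1 := key (p + 1)
      have k2 := key p
      rw [Finsupp.add_apply, Finsupp.single_eq_same, Finsupp.single_eq_of_ne (by omega),
        add_zero, add_sub_cancel_right] at k1
      rw [Finsupp.add_apply, Finsupp.single_eq_same, Finsupp.single_eq_of_ne (by omega),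
        zero_add] at k2
      have e1 : p + q + 1 - (p + 1) - 1 = q - 1 := by ring
      have e2 : p + q + 1 - p - 1 = q := by ring
      rw [e1] at k1
      rw [e2] at k2
      exact ⟨k1, k2⟩
    · intro r
      rw [Finsupp.add_apply]
      refine Submodule.add_mem _ ?_ ?_
      · by_cases hr : r = p + 1
        · subst hr
          have e1 : p + q + 1 - (p + 1) = q := by ring
          rw [Finsupp.single_eq_same, e1]
          exact ⟨⟨h.sq1 _, h0'⟩, hu1⟩
        · rw [Finsupp.single_eq_of_ne hr]
          exact Submodule.zero_mem _
      · by_cases hr : r = p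
        · subst hr
          have e1 : r + q + 1 - r = q + 1 := by ring
          rw [Finsupp.single_eq_same, e1]
          exact ⟨⟨h0, h.sq2 _⟩, hu2⟩
        · rw [Finsupp.single_eq_of_ne hr]
          exact Submodule.zero_mem _
    · rw [Finsupp.sum_add_index' (fun _ => rfl) (fun _ _ _ => rfl), Finsupp.sum_single_index rfl,
        Finsupp.sum_single_index rfl]
      exact ⟨u, Bi.mem_tk p q _ (by ring) hu, rfl⟩
  have ha : ∀ p q, aL 𝒜 d1 d2 p q = 0 := by
    intro p q
    unfold aL
    rw [rl_eq_zero]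
    rintro _ ⟨⟨u, hu, rfl⟩, hx⟩
    have h2 : d2 (d1 u) = 0 := (I2_le_K2 h p q hx).1
    exact (hC (p - 1) q u hu (by rw [h.anti, h2, neg_zero])).1
  have hf : ∀ p q, fL 𝒜 d1 d2 p q = 0 := by
    intro p q
    unfold fL
    rw [rl_eq_zero]
    rintro u ⟨h0, hu⟩
    obtain ⟨w, hw, hwu⟩ := (hC p q u hu h0).1
    have e : u = (u - d2 w) + d2 w := by abel
    rw [e]
    have hw2 : d2 w ∈ 𝒜 p q := h.hd2 _ _ _ hw
    refine Submodule.add_mem_sup ⟨?_, Submodule.sub_mem _ hu hw2⟩ ⟨h.sq2 _, hw2⟩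
    change d1 (u - d2 w) = 0
    rw [map_sub, ← hwu]
    exact sub_self _
  have hI : ∀ k p z, z ∈ 𝒜 p (k - p) → d1 z = 0 → d2 z = 0 → z ∈ Bk 𝒜 d1 d2 k →
      z ∈ (𝒜 (p - 1) (k - p)).map d1 ⊓ (𝒜 p (k - p - 1)).map d2 :=
    fun k p z hz h1 h2 hzB => I12_le h p (k - p) (hB k p z hz h1 h2 hzB)
  rw [total h k, Finset.sum_eq_zero (f := fun p => aL 𝒜 d1 d2 p (k - p)) fun p _ => ha p _,
    Finset.sum_eq_zero (f := fun p => fL 𝒜 d1 d2 p (k - p)) fun p _ => hf p _,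
    add_zero, add_zero, two_mul, F3 h k, F3' h k]
  · exact fun p z hz h1 h2 hzB => (hI k p z hz h1 h2 hzB).1
  · intro p u hu h1
    obtain ⟨w, hw, hwu⟩ := (hC p (k - p) u hu (by rw [h.anti, h1, map_zero, neg_zero])).2
    refine ⟨- w, Submodule.neg_mem _ hw, ?_⟩
    rw [map_neg, sub_neg_eq_add, map_add, ← hwu]
    change d1 (d2 w) + d2 (d1 w) = 0
    rw [h.anti, neg_add_cancel]
  · exact fun p z hz h1 h2 hzB => (hI k p z hz h1 h2 hzB).2
  · intro p u hu h2
    obtain ⟨w, hw, hwu⟩ := (hC p (k - p) u hu (by rw [h2, map_zero])).1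
    refine ⟨w, hw, ?_⟩
    rw [map_sub, ← hwu]
    exact sub_self _

end Final

/-- **Frölicher-type inequality for Bott-Chern cohomology
([angella-tomassini-5, Theorem A/4.4]).**
Let `(A^{•,•}, ∂, ∂̄)` be a bounded double complex of ℂ-vector spaces with all
`H^{p,q}_∂` and `H^{p,q}_∂̄` finite-dimensional. Then for every `k ∈ ℤ`,
`Σ_{p+q=k} dim H^{p,q}_{BC} + Σ_{p+q=k} dim H^{p,q}_{A} ≥ 2 dim H^k_{dR}`,
and equality holds for every `k` if and only if the natural map
`⊕_{p+q=•} H^{p,q}_{BC} → H^•_{dR}` is injective (the `∂∂̄`-Lemma). -/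
theorem stmt8 (M : Type*) [AddCommGroup M] [Module ℂ M]
    (𝒜 : ℤ → ℤ → Submodule ℂ M)
    (hinternal : DirectSum.IsInternal fun pq : ℤ × ℤ => 𝒜 pq.1 pq.2)
    (hbound : {pq : ℤ × ℤ | 𝒜 pq.1 pq.2 ≠ ⊥}.Finite)
    (d1 d2 : Module.End ℂ M)
    (hd1 : ∀ p q : ℤ, (𝒜 p q).map d1 ≤ 𝒜 (p + 1) q)
    (hd2 : ∀ p q : ℤ, (𝒜 p q).map d2 ≤ 𝒜 p (q + 1))
    (hd1sq : d1 * d1 = 0) (hd2sq : d2 * d2 = 0)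
    (hanti : d1 * d2 + d2 * d1 = 0)
    (hfin1 : ∀ p q : ℤ, FiniteDimensional ℂ (cohD d1 (𝒜 p q) (𝒜 (p - 1) q)))
    (hfin2 : ∀ p q : ℤ, FiniteDimensional ℂ (cohD d2 (𝒜 p q) (𝒜 p (q - 1)))) :
    (∀ k : ℤ,
      2 * Module.finrank ℂ
          (cohD (d1 + d2) (⨆ r : ℤ, 𝒜 r (k - r)) (⨆ r : ℤ, 𝒜 r (k - 1 - r))) ≤
        (∑ᶠ p : ℤ,
          Module.finrank ℂ (cohBC d1 d2 (𝒜 p (k - p)) (𝒜 (p - 1) (k - p - 1)))) +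
        (∑ᶠ p : ℤ,
          Module.finrank ℂ
            (cohA d1 d2 (𝒜 p (k - p)) (𝒜 (p - 1) (k - p)) (𝒜 p (k - p - 1))))) ∧
    ((∀ k : ℤ,
        (∑ᶠ p : ℤ,
          Module.finrank ℂ (cohBC d1 d2 (𝒜 p (k - p)) (𝒜 (p - 1) (k - p - 1)))) +
        (∑ᶠ p : ℤ,
          Module.finrank ℂ
            (cohA d1 d2 (𝒜 p (k - p)) (𝒜 (p - 1) (k - p)) (𝒜 p (k - p - 1)))) =
        2 * Module.finrank ℂ
          (cohD (d1 + d2) (⨆ r : ℤ, 𝒜 r (k - r)) (⨆ r : ℤ, 𝒜 r (k - 1 - r)))) ↔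
      -- the `∂∂̄`-Lemma: the natural map `⊕_{p+q=k} H^{p,q}_{BC} → H^k_{dR}` is injective
      (∀ (k : ℤ) (a : ℤ →₀ M),
        (∀ p : ℤ, a p ∈ ker d1 ⊓ ker d2 ⊓ 𝒜 p (k - p)) →
        (a.sum fun _ m => m) ∈ (⨆ r : ℤ, 𝒜 r (k - 1 - r)).map (d1 + d2) →
        ∀ p : ℤ, a p ∈ (𝒜 (p - 1) (k - p - 1)).map (d1 * d2))) := by
  obtain ⟨π, lo, hi, h⟩ :=
    exists_bi 𝒜 hinternal hbound d1 d2 hd1 hd2 hd1sq hd2sq hanti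
  have H1 : ∀ p q, h1l 𝒜 d1 p q ≠ ⊤ := fun p q => rl_ne_top (hfin1 p q)
  have H2 : ∀ p q, h2l 𝒜 d2 p q ≠ ⊤ := fun p q => rl_ne_top (hfin2 p q)
  have HA : ∀ p q, aL 𝒜 d1 d2 p q ≠ ⊤ := fun p q =>
    aL_fin h H1 H2 (p - lo + 1).toNat p q (by omega)
  have HF : ∀ p q, fL 𝒜 d1 d2 p q ≠ ⊤ := fun p q =>
    ne_top_of_le_ne_top (WithTop.add_ne_top.2 ⟨HA _ _, H1 _ _⟩) (fL_le h p q)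
  have HBA : ∀ p q, bcL 𝒜 d1 d2 p q + apL 𝒜 d1 d2 p q ≠ ⊤ := by
    intro p q
    rw [bc_ap h]
    exact WithTop.add_ne_top.2 ⟨WithTop.add_ne_top.2 ⟨WithTop.add_ne_top.2
      ⟨H1 _ _, H2 _ _⟩, HA _ _⟩, HF _ _⟩
  have HBC : ∀ p q, bcL 𝒜 d1 d2 p q ≠ ⊤ := fun p q => (WithTop.add_ne_top.1 (HBA p q)).1
  have HAp : ∀ p q, apL 𝒜 d1 d2 p q ≠ ⊤ := fun p q => (WithTop.add_ne_top.1 (HBA p q)).2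
  have Hb : ∀ k, rl (Bk 𝒜 d1 d2 k) (Zk 𝒜 d1 d2 k) ≠ ⊤ := by
    intro k
    refine ne_top_of_le_ne_top ?_ (F1 h k)
    exact WithTop.sum_ne_top.2 fun p _ => H2 _ _
  have Eb : ∀ k : ℤ, ((Module.finrank ℂ (cohD (d1 + d2) (⨆ r : ℤ, 𝒜 r (k - r))
      (⨆ r : ℤ, 𝒜 r (k - 1 - r))) : ℕ) : ℕ∞) = rl (Bk 𝒜 d1 d2 k) (Zk 𝒜 d1 d2 k) :=
    fun k => rl_finrank (Hb k)
  have Ebc : ∀ k : ℤ, ((∑ᶠ p : ℤ, Module.finrank ℂ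
      (cohBC d1 d2 (𝒜 p (k - p)) (𝒜 (p - 1) (k - p - 1))) : ℕ) : ℕ∞) =
      ∑ p ∈ Finset.Icc lo hi, bcL 𝒜 d1 d2 p (k - p) := by
    intro k
    refine finsum_cast lo hi _ _ (fun p => rl_finrank (HBC p (k - p))) ?_
    intro p hp
    rw [rl_eq_zero, h.bp p _ hp]
    simp
  have Eap : ∀ k : ℤ, ((∑ᶠ p : ℤ, Module.finrank ℂ
      (cohA d1 d2 (𝒜 p (k - p)) (𝒜 (p - 1) (k - p)) (𝒜 p (k - p - 1))) : ℕ) : ℕ∞) =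
      ∑ p ∈ Finset.Icc lo hi, apL 𝒜 d1 d2 p (k - p) := by
    intro k
    refine finsum_cast lo hi _ _ (fun p => rl_finrank (HAp p (k - p))) ?_
    intro p hp
    rw [rl_eq_zero, h.bp p (k - p) hp]
    simp
  refine ⟨?_, ?_, ?_⟩
  · intro k
    rw [← Nat.cast_le (α := ℕ∞), Nat.cast_add, Nat.cast_mul, Eb, Ebc, Eap, total h k, Nat.cast_ofNat,
      two_mul]
    exact (add_le_add (F1' h k) (F1 h k)).trans (le_self_add.trans le_self_add)
  · intro heq
    refine ddbar_of_eq h Hb fun k => ?_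
    rw [← Ebc, ← Eap, ← Eb, ← Nat.cast_add, heq k, Nat.cast_mul, Nat.cast_ofNat]
  · intro hD k
    rw [← Nat.cast_inj (R := ℕ∞), Nat.cast_add, Nat.cast_mul, Eb, Ebc, Eap, Nat.cast_ofNat]
    exact eq_of_ddbar h hD k
end

section
/- Let V be a (possibly infinite-dimensional) ℂ-vector space and φ : sl₂(ℂ) → End(V) a Lie algebra representation of finite Z-spectrum, i.e., V is the direct sum of the eigenspaces of φ(Z) and φ(Z) has only finitely many distinct eigenvalues, where Z = diag(-1,1) is the standard diagonal element of sl₂(ℂ). Then every eigenvalue of φ(Z) is an integer. -/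
lemma nilp_aux {V : Type*} [AddCommGroup V] [Module ℂ V] (Z : Module.End ℂ V)
    (hfin : {μ : ℂ | Module.End.eigenspace Z μ ≠ ⊥}.Finite) (a c : ℂ) (hc : c ≠ 0)
    (w : ℕ → V) (hw : ∀ n : ℕ, Z (w n) = (a + c * n) • w n) : ∃ n, w n = 0 := by
  by_contra! h
  have hinj : Function.Injective (fun n : ℕ => a + c * (n : ℂ)) := by
    intro m n hmn
    simpa [hc] using hmn
  refine Set.infinite_range_of_injective hinj (hfin.subset ?_)
  rintro _ ⟨n, rfl⟩
  exact (Submodule.ne_bot_iff _).2 ⟨w n, Module.End.mem_eigenspace_iff.2 (hw n), h n⟩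

/-- **Integrality of eigenvalues (Yan, Corollary 2.4).**
Let `V` be a (possibly infinite-dimensional) ℂ-vector space and let `X`, `Y`, `Z` be
operators giving a representation of `sl₂(ℂ)` in the standard basis `X = E₁₂`,
`Y = E₂₁`, `Z = diag(-1,1)` (so `[X,Y] = -Z`, `[Z,X] = -2X`, `[Z,Y] = 2Y`), of finite
`Z`-spectrum: `V` is the direct sum of the eigenspaces of `Z`, and `Z` has only
finitely many distinct eigenvalues. Then every eigenvalue of `Z` is an integer. -/
theorem stmt12 (V : Type*) [AddCommGroup V] [Module ℂ V]
    (X Y Z : Module.End ℂ V)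
    (hXY : ⁅X, Y⁆ = -Z)
    (hZX : ⁅Z, X⁆ = (-2 : ℂ) • X)
    (hZY : ⁅Z, Y⁆ = (2 : ℂ) • Y)
    (hinternal : DirectSum.IsInternal fun μ : ℂ => Module.End.eigenspace Z μ)
    (hfin : {μ : ℂ | Module.End.eigenspace Z μ ≠ ⊥}.Finite) :
    ∀ μ : ℂ, Module.End.HasEigenvalue Z μ → ∃ m : ℤ, μ = (m : ℂ) := by
  intro μ hμ
  obtain ⟨v, hv⟩ := hμ.exists_hasEigenvector
  by_cases hZ0 : Z = 0
  · refine ⟨0, ?_⟩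
    have h1 := hv.apply_eq_smul
    rw [hZ0, LinearMap.zero_apply, eq_comm, smul_eq_zero] at h1
    simpa using h1.resolve_right hv.2
  letI : LieRing (Module.End ℂ V) := LieRing.ofAssociativeRing
  have t : IsSl2Triple Z Y X :=
    { h_ne_zero := hZ0
      lie_e_f := by
        have h0 : X * Y - Y * X = -Z := hXY
        change Y * X - X * Y = Z
        rw [← neg_sub, h0, neg_neg]
      lie_h_e_nsmul := by
        refine Eq.trans hZY ?_
        rw [two_smul, two_nsmul]
      lie_h_f_nsmul := by
        refine Eq.trans hZX ?_
        rw [neg_smul, two_smul, two_nsmul] }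
  have hv' : ⁅Z, v⁆ = μ • v := hv.apply_eq_smul
  obtain ⟨k, hk, hk'⟩ := Nat.exists_not_and_succ_of_not_zero_of_exists
    (p := fun n => ((LieModule.toEnd ℂ (Module.End ℂ V) V Y) ^ n) v = 0) (by simpa using hv.2)
    (nilp_aux Z hfin μ 2 two_ne_zero _ (fun n => t.lie_h_pow_toEnd_e hv' n))
  have P : t.HasPrimitiveVectorWith (((LieModule.toEnd ℂ (Module.End ℂ V) V Y) ^ k) v)
      (μ + 2 * k) :=
    { ne_zero := hk
      lie_h := t.lie_h_pow_toEnd_e hv' k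
      lie_e := by rw [IsSl2Triple.lie_e_pow_toEnd_e]; exact hk' }
  obtain ⟨n, hn, hn'⟩ := Nat.exists_not_and_succ_of_not_zero_of_exists
    (p := fun n => ((LieModule.toEnd ℂ (Module.End ℂ V) V X) ^ n)
      (((LieModule.toEnd ℂ (Module.End ℂ V) V Y) ^ k) v) = 0) (by simpa using hk)
    (nilp_aux Z hfin (μ + 2 * k) (-2) (by norm_num) _ (fun n => by
      rw [neg_mul, ← sub_eq_add_neg]; exact P.lie_h_pow_toEnd_f n))
  have h2 := P.lie_e_pow_succ_toEnd_f n
  rw [hn', lie_zero, eq_comm, smul_eq_zero_iff_left hn, mul_eq_zero, sub_eq_zero] at h2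
  have h3 := h2.resolve_left (Nat.cast_add_one_ne_zero n)
  refine ⟨n - 2 * k, ?_⟩
  push_cast
  rw [← h3]
  ring
end

section
/- Let V be a (possibly infinite-dimensional) ℂ-vector space and φ : sl₂(ℂ) → End(V) a Lie algebra representation of finite Z-spectrum. For k ∈ ℤ let V_k denote the eigenspace of φ(Z) with eigenvalue k. Then for every natural number k, the maps φ(X)^k : V_k → V_{-k} and φ(Y)^k : V_{-k} → V_k are linear isomorphisms. -/
open Polynomial in
theorem aux_core {V : Type*} [AddCommGroup V] [Module ℂ V]
    (E F H : Module.End ℂ V)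
    (h1 : ∀ v, E (F v) = F (E v) + H v)
    (h2 : ∀ v, H (E v) = E (H v) + (2 : ℂ) • E v)
    (h3 : ∀ v, H (F v) = F (H v) - (2 : ℂ) • F v)
    (hfin : {μ : ℂ | Module.End.eigenspace H μ ≠ ⊥}.Finite) (k : ℕ) :
    (∀ v, H v = (k : ℂ) • v → H ((F ^ k) v) = (-(k : ℂ)) • (F ^ k) v) ∧
    (∀ v, H v = (k : ℂ) • v → (F ^ k) v = 0 → v = 0) ∧
    (∀ v, H v = (k : ℂ) • v → ∃ u, H u = (k : ℂ) • u ∧ (E ^ k) ((F ^ k) u) = v) := by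
  have wF : ∀ (μ : ℂ) v, H v = μ • v → H (F v) = (μ - 2) • F v := by
    intro μ v hv
    rw [h3, hv, map_smul, sub_smul]
  have wE : ∀ (μ : ℂ) v, H v = μ • v → H (E v) = (μ + 2) • E v := by
    intro μ v hv
    rw [h2, hv, map_smul, add_smul]
  have wFn : ∀ (n : ℕ) (μ : ℂ) v, H v = μ • v → H ((F ^ n) v) = (μ - 2 * n) • (F ^ n) v := by
    intro n
    induction n with
    | zero => intro μ v hv; simpa using hv
    | succ n ih =>
      intro μ v hv
      rw [pow_succ, Module.End.mul_apply, ih _ _ (wF μ v hv)]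
      congr 1; push_cast; ring
  have wEn : ∀ (n : ℕ) (μ : ℂ) v, H v = μ • v → H ((E ^ n) v) = (μ + 2 * n) • (E ^ n) v := by
    intro n
    induction n with
    | zero => intro μ v hv; simpa using hv
    | succ n ih =>
      intro μ v hv
      rw [pow_succ, Module.End.mul_apply, ih _ _ (wE μ v hv)]
      congr 1; push_cast; ring
  have sF : ∀ (n : ℕ) (μ : ℂ) v, H v = μ • v →
      E ((F ^ (n + 1)) v) = (F ^ n) (F (E v) + (((n : ℂ) + 1) * (μ - n)) • v) := by
    intro n
    induction n with
    | zero => intro μ v hv; simp [h1, hv]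
    | succ n ih =>
      intro μ v hv
      rw [pow_succ F (n + 1), Module.End.mul_apply, ih _ _ (wF μ v hv), pow_succ F n,
        Module.End.mul_apply]
      congr 1
      rw [h1, hv, map_add, map_add, map_smul, map_smul, add_assoc, ← add_smul]
      congr 2; push_cast; ring
  have sE : ∀ (n : ℕ) (μ : ℂ) v, H v = μ • v →
      F ((E ^ (n + 1)) v) = (E ^ n) (F (E v) + (-((n : ℂ) * (μ + n + 1))) • v) := by
    intro n
    induction n with
    | zero => intro μ v hv; simp
    | succ n ih =>
      intro μ v hv
      rw [pow_succ E (n + 1), Module.End.mul_apply, ih _ _ (wE μ v hv), pow_succ E n,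
        Module.End.mul_apply]
      congr 1
      have : F (E (E v)) = E (F (E v)) - (μ + 2) • E v := by
        rw [h1, wE μ v hv]; abel
      rw [this, map_add, map_smul, sub_eq_add_neg, add_assoc, ← neg_smul, ← add_smul]
      congr 2; push_cast; ring
  have wN : ∀ (μ : ℂ) v, H v = μ • v → H (F (E v)) = μ • F (E v) := by
    intro μ v hv
    rw [wF _ _ (wE μ v hv)]; congr 1; ring
  have wP : ∀ (p : ℂ[X]) (μ : ℂ) v, H v = μ • v → H (aeval (F * E) p v) = μ • aeval (F * E) p v := by
    intro p μ v hv
    induction p using Polynomial.induction_on' with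
    | add p q hp hq => simp only [map_add, LinearMap.add_apply, hp, hq, smul_add]
    | monomial n a =>
      rw [aeval_monomial]
      simp only [Module.End.mul_apply, Module.algebraMap_end_apply, map_smul]
      rw [smul_comm μ a]
      congr 1
      induction n with
      | zero => simpa using hv
      | succ n ih =>
        rw [pow_succ', Module.End.mul_apply, Module.End.mul_apply]
        exact wN _ _ ih
  have PF : ∀ (n : ℕ) (μ : ℂ) v, H v = μ • v → (E ^ n) ((F ^ n) v) =
      aeval (F * E) (∏ j ∈ Finset.range n, (X + C (((j : ℂ) + 1) * (μ - j)))) v := by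
    intro n μ
    induction n with
    | zero => intro v hv; simp
    | succ n ih =>
      intro v hv
      rw [pow_succ E, Module.End.mul_apply, sF n μ v hv, ih, Finset.prod_range_succ, map_mul,
        Module.End.mul_apply]
      · congr 1
        rw [map_add, aeval_X, aeval_C, LinearMap.add_apply, Module.End.mul_apply,
          Module.algebraMap_end_apply]
      · rw [map_add, wN μ v hv, map_smul, hv, smul_add, smul_comm]
  have PE : ∀ (n : ℕ) (μ : ℂ) v, H v = μ • v → (F ^ n) ((E ^ n) v) =
      aeval (F * E) (∏ j ∈ Finset.range n, (X + C (-((j : ℂ) * (μ + j + 1))))) v := by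
    intro n μ
    induction n with
    | zero => intro v hv; simp
    | succ n ih =>
      intro v hv
      rw [pow_succ F, Module.End.mul_apply, sE n μ v hv, ih, Finset.prod_range_succ, map_mul,
        Module.End.mul_apply]
      · congr 1
        rw [map_add, aeval_X, aeval_C, LinearMap.add_apply, Module.End.mul_apply,
          Module.algebraMap_end_apply]
      · rw [map_add, wN μ v hv, map_smul, hv, smul_add, smul_comm]
  have nil : ∀ (μ : ℂ) v, H v = μ • v → ∃ n : ℕ, (E ^ n) v = 0 := by
    intro μ v hv
    by_contra! hne
    have hinj : Function.Injective (fun n : ℕ => μ + 2 * (n : ℂ)) := by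
      intro a b hab
      simpa using hab
    refine Set.infinite_of_injective_forall_mem hinj (fun n => ?_) hfin
    intro hb
    apply hne n
    rw [← Submodule.mem_bot ℂ, ← hb, Module.End.mem_eigenspace_iff]
    exact wEn n μ v hv
  have key : ∀ v, H v = (k : ℂ) • v → ∃ U : ℂ[X],
      aeval (F * E) (U * ∏ j ∈ Finset.range k, (X + C (((j : ℂ) + 1) * (k - j)))) v = v := by
    intro v hv
    obtain ⟨n, hn⟩ := nil _ v hv
    have hc : IsCoprime (∏ j ∈ Finset.range k, (X + C (((j : ℂ) + 1) * (k - j))))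
        (∏ j ∈ Finset.range n, (X + C (-((j : ℂ) * (k + j + 1))))) := by
      refine IsCoprime.prod_left fun i hi => IsCoprime.prod_right fun j hj => ?_
      have hik := Finset.mem_range.1 hi
      obtain ⟨d, rfl⟩ := Nat.exists_eq_add_of_lt hik
      rw [← sub_neg_eq_add X, ← sub_neg_eq_add X, ← C_neg, ← C_neg]
      apply isCoprime_X_sub_C_of_isUnit_sub
      rw [isUnit_iff_ne_zero]
      intro h0
      have h0' : (((i + 1) * (d + 1) + j * ((i + d + 1) + j + 1) : ℕ) : ℂ) = 0 := by
        push_cast at h0 ⊢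
        linear_combination -h0
      rw [Nat.cast_eq_zero] at h0'
      have : 0 < (i + 1) * (d + 1) := by positivity
      omega
    obtain ⟨U, W, hUW⟩ := hc
    refine ⟨U, ?_⟩
    have h := congrArg (fun p => aeval (F * E) p v) hUW
    simp only [map_add, LinearMap.add_apply, map_one, Module.End.one_apply] at h
    rw [map_mul _ W, Module.End.mul_apply, ← PE n _ v hv, hn] at h
    simpa using h
  refine ⟨fun v hv => ?_, fun v hv h0 => ?_, fun v hv => ?_⟩
  · rw [wFn k _ v hv]; congr 1; ring
  · obtain ⟨U, hU⟩ := key v hv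
    rw [map_mul, Module.End.mul_apply, ← PF k _ v hv, h0] at hU
    simpa using hU.symm
  · obtain ⟨U, hU⟩ := key v hv
    refine ⟨aeval (F * E) U v, wP U _ v hv, ?_⟩
    rw [PF k _ _ (wP U _ v hv), ← Module.End.mul_apply, ← map_mul, mul_comm]
    exact hU


/-- **Yan, Corollary 2.5.**
Let `V` be a (possibly infinite-dimensional) ℂ-vector space and let `X`, `Y`, `Z` be
operators giving a representation of `sl₂(ℂ)` in the standard basis `X = E₁₂`,
`Y = E₂₁`, `Z = diag(-1,1)` (so `[X,Y] = -Z`, `[Z,X] = -2X`, `[Z,Y] = 2Y`), of finite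
`Z`-spectrum. Writing `V_k` for the eigenspace of `Z` with eigenvalue `k`, for every
natural number `k` the maps `X^k : V_k → V_{-k}` and `Y^k : V_{-k} → V_k` are linear
isomorphisms. -/
theorem stmt13 (V : Type*) [AddCommGroup V] [Module ℂ V]
    (X Y Z : Module.End ℂ V)
    (hXY : ⁅X, Y⁆ = -Z)
    (hZX : ⁅Z, X⁆ = (-2 : ℂ) • X)
    (hZY : ⁅Z, Y⁆ = (2 : ℂ) • Y)
    (hinternal : DirectSum.IsInternal fun μ : ℂ => Module.End.eigenspace Z μ)
    (hfin : {μ : ℂ | Module.End.eigenspace Z μ ≠ ⊥}.Finite) :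
    ∀ k : ℕ,
      ((∀ v ∈ Module.End.eigenspace Z (k : ℂ),
          (X ^ k) v ∈ Module.End.eigenspace Z (-(k : ℂ))) ∧
        (∀ v ∈ Module.End.eigenspace Z (k : ℂ), (X ^ k) v = 0 → v = 0) ∧
        (∀ w ∈ Module.End.eigenspace Z (-(k : ℂ)),
          ∃ v ∈ Module.End.eigenspace Z (k : ℂ), (X ^ k) v = w)) ∧
      ((∀ v ∈ Module.End.eigenspace Z (-(k : ℂ)),
          (Y ^ k) v ∈ Module.End.eigenspace Z (k : ℂ)) ∧
        (∀ v ∈ Module.End.eigenspace Z (-(k : ℂ)), (Y ^ k) v = 0 → v = 0) ∧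
        (∀ w ∈ Module.End.eigenspace Z (k : ℂ),
          ∃ v ∈ Module.End.eigenspace Z (-(k : ℂ)), (Y ^ k) v = w)) := by
  intro k
  have e1 : ∀ v, X (Y v) - Y (X v) = -Z v := fun v => by
    simpa [Ring.lie_def] using congrArg (fun f : Module.End ℂ V => f v) hXY
  have e2 : ∀ v, Z (X v) - X (Z v) = (-2 : ℂ) • X v := fun v => by
    simpa [Ring.lie_def] using congrArg (fun f : Module.End ℂ V => f v) hZX
  have e3 : ∀ v, Z (Y v) - Y (Z v) = (2 : ℂ) • Y v := fun v => by
    simpa [Ring.lie_def] using congrArg (fun f : Module.End ℂ V => f v) hZY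
  obtain ⟨a1, a2, a3⟩ := aux_core Y X Z
    (fun v => by
      have := e1 v
      rw [sub_eq_iff_eq_add] at this
      rw [this]; abel)
    (fun v => by rw [← e3 v]; abel)
    (fun v => by
      have := e2 v
      rw [sub_eq_iff_eq_add] at this
      rw [this, neg_smul]; abel) hfin k
  have hfin' : {μ : ℂ | Module.End.eigenspace (-Z) μ ≠ ⊥}.Finite := by
    have := hfin.image (fun μ => -μ)
    refine this.subset ?_
    intro μ hμ
    refine ⟨-μ, ?_, neg_neg μ⟩
    intro hb
    apply hμ
    rw [eq_bot_iff] at hb ⊢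
    intro v hv
    apply hb
    rw [Module.End.mem_eigenspace_iff] at hv ⊢
    rw [neg_smul, ← hv, LinearMap.neg_apply, neg_neg]
  obtain ⟨b1, b2, b3⟩ := aux_core X Y (-Z)
    (fun v => by
      have := e1 v
      rw [sub_eq_iff_eq_add] at this
      rw [this, LinearMap.neg_apply]; abel)
    (fun v => by
      have := e2 v
      rw [sub_eq_iff_eq_add] at this
      rw [LinearMap.neg_apply, LinearMap.neg_apply, this, map_neg, neg_smul]; abel)
    (fun v => by
      rw [LinearMap.neg_apply, LinearMap.neg_apply, ← e3 v, map_neg]; abel) hfin' k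
  have hn : ∀ (μ : ℂ) v, (-Z) v = μ • v ↔ Z v = (-μ) • v := by
    intro μ v
    rw [LinearMap.neg_apply, neg_smul, neg_eq_iff_eq_neg]
  simp only [hn, neg_neg] at b1 b2 b3
  simp only [Module.End.mem_eigenspace_iff]
  refine ⟨⟨a1, a2, fun w hw => ?_⟩, ⟨b1, b2, fun w hw => ?_⟩⟩
  · obtain ⟨u, hu, h⟩ := b3 w hw
    exact ⟨_, b1 u hu, h⟩
  · obtain ⟨u, hu, h⟩ := a3 w hw
    exact ⟨_, a1 u hu, h⟩
end
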